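/- arXiv:1908.00526 — 2 statements merged into one kernel-verified Lean document; each statement's English description precedes it below -/
import Mathlib

section
/- Fix e ∈ [0,1) and ω ∈ ℂ with |ω| = 1 and ω ≠ 1. Then the set S = { β ∈ [0,1] : det(γ_{β,e}(2π) − ω I₂) = 0, determinant taken over ℂ } is a finite subset of the open interval (0,1), and the total multiplicity Σ_{β ∈ S} dim_ℂ ker(γ_{β,e}(2π) − ω I₂) equals 2. -/
open Real Matrix

attribute [local instance] Matrix.normedAddCommGroup

noncomputable section

/-- The standard symplectic matrix `J = [[0,-1],[1,0]]`. -/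
def Jmat : Matrix (Fin 2) (Fin 2) ℝ := !![0, -1; 1, 0]

/-- The coefficient matrix `B_{β,e}(t) = diag(1, 1 - β/(1 + e cos t))`. -/
def Bmat (β e t : ℝ) : Matrix (Fin 2) (Fin 2) ℝ :=
  !![1, 0; 0, 1 - β / (1 + e * Real.cos t)]

/-- `γ` is the fundamental solution of `γ' = J B_{β,e} γ`, `γ(0) = I₂`
(derivative taken entrywise). -/
def IsFundSol (β e : ℝ) (γ : ℝ → Matrix (Fin 2) (Fin 2) ℝ) : Prop :=
  γ 0 = 1 ∧ ∀ (t : ℝ) (i j : Fin 2),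
    HasDerivAt (fun s => γ s i j) ((Jmat * Bmat β e t * γ t) i j) t

/-- The trace-formula function `f(β,-1)`. -/
def fTrace (β : ℝ) : ℝ :=
  β ^ 2 / (2 * (1 - β)) *
    ∫ s in (π / 2)..(3 * π / 2), ∫ t in (π / 2)..(3 * π / 2),
      Real.cos s * Real.cos t *
        (Real.cos (2 * π * Real.sqrt (1 - β) * (s - t)) ^ 2 /
            Real.cos (π * Real.sqrt (1 - β)) ^ 2 -
          Real.cos (4 * π * Real.sqrt (1 - β) * (s - t + 1 / 4)) /
            Real.cos (π * Real.sqrt (1 - β)))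


lemma aux_wirt_k (u u' : ℝ → ℝ) (a k : ℝ) (hk0 : 0 < k) (hk1 : k < 1)
    (hu : ∀ t, HasDerivAt u (u' t) t) (hu' : Continuous u')
    (ha : u a = 0) (hb : u (a + π) = 0) :
    k ^ 2 * ∫ t in a..(a + π), (u t) ^ 2 ≤ ∫ t in a..(a + π), (u' t) ^ 2 := by
  have hπ := Real.pi_pos
  have hab : a ≤ a + π := by linarith
  have huc : Continuous u := continuous_iff_continuousAt.2 fun t => (hu t).continuousAt
  set θ : ℝ → ℝ := fun t => k * (t - a - π / 2) with hθ
  have hθd : ∀ t, HasDerivAt θ k t := by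
    intro t
    have := (((hasDerivAt_id t).sub_const a).sub_const (π / 2)).const_mul k
    simpa using this
  have hcos : ∀ t ∈ Set.Icc a (a + π), 0 < Real.cos (θ t) := by
    intro t ht
    apply Real.cos_pos_of_mem_Ioo
    constructor
    · simp only [hθ]; nlinarith [ht.1, ht.2]
    · simp only [hθ]; nlinarith [ht.1, ht.2]
  set τ : ℝ → ℝ := fun t => -k * (Real.sin (θ t) / Real.cos (θ t)) with hτ
  have hτd : ∀ t ∈ Set.Icc a (a + π), HasDerivAt τ (-k ^ 2 - (τ t) ^ 2) t := by
    intro t ht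
    have hc := (hcos t ht).ne'
    have := (((hθd t).sin).div ((hθd t).cos) hc).const_mul (-k)
    refine this.congr_deriv ?_
    simp only [hτ]
    field_simp
    ring
  have hθc : Continuous θ := continuous_iff_continuousAt.2 fun t => (hθd t).continuousAt
  have hτc : ContinuousOn τ (Set.uIcc a (a + π)) := by
    rw [Set.uIcc_of_le hab]
    exact fun t ht => (hτd t ht).continuousAt.continuousWithinAt
  have hF : ∀ t ∈ Set.uIcc a (a + π), HasDerivAt (fun s => (u s) ^ 2 * τ s)
      (2 * u t * u' t * τ t + (u t) ^ 2 * (-k ^ 2 - (τ t) ^ 2)) t := by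
    intro t ht
    rw [Set.uIcc_of_le hab] at ht
    have := ((hu t).pow 2).mul (hτd t ht)
    refine this.congr_deriv ?_
    simp
  have hci : IntervalIntegrable (fun t => 2 * u t * u' t * τ t + (u t) ^ 2 * (-k ^ 2 - (τ t) ^ 2))
      MeasureTheory.volume a (a + π) := by
    apply ContinuousOn.intervalIntegrable
    have h1 := huc.continuousOn (s := Set.uIcc a (a + π))
    have h2 := hu'.continuousOn (s := Set.uIcc a (a + π))
    fun_prop
  have h0 := intervalIntegral.integral_eq_sub_of_hasDerivAt hF hci
  simp only [ha, hb] at h0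
  have hi1 : IntervalIntegrable (fun t => (u' t) ^ 2) MeasureTheory.volume a (a + π) :=
    (hu'.pow 2).intervalIntegrable _ _
  have hi2 : IntervalIntegrable (fun t => k ^ 2 * (u t) ^ 2) MeasureTheory.volume a (a + π) :=
    ((huc.pow 2).const_smul (k ^ 2)).intervalIntegrable _ _
  have hm : ∫ t in a..(a + π), (2 * u t * u' t * τ t + (u t) ^ 2 * (-k ^ 2 - (τ t) ^ 2)) ≤
      ∫ t in a..(a + π), ((u' t) ^ 2 - k ^ 2 * (u t) ^ 2) := by
    apply intervalIntegral.integral_mono_on hab hci (hi1.sub hi2)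
    intro t _
    nlinarith [sq_nonneg (u' t - u t * τ t)]
  rw [intervalIntegral.integral_sub hi1 hi2, intervalIntegral.integral_const_mul, h0] at hm
  linarith

lemma aux_wirt (u u' : ℝ → ℝ) (a : ℝ)
    (hu : ∀ t, HasDerivAt u (u' t) t) (hu' : Continuous u')
    (ha : u a = 0) (hb : u (a + π) = 0) :
    ∫ t in a..(a + π), (u t) ^ 2 ≤ ∫ t in a..(a + π), (u' t) ^ 2 := by
  set I := ∫ t in a..(a + π), (u t) ^ 2
  set I' := ∫ t in a..(a + π), (u' t) ^ 2
  have ht : Filter.Tendsto (fun k : ℝ => k ^ 2 * I) (nhdsWithin 1 (Set.Iio 1)) (nhds (1 ^ 2 * I)) := by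
    have : Continuous (fun k : ℝ => k ^ 2 * I) := by fun_prop
    exact (this.tendsto 1).mono_left nhdsWithin_le_nhds
  have : (1 : ℝ) ^ 2 * I ≤ I' := by
    apply le_of_tendsto ht
    have : Set.Ioo (0 : ℝ) 1 ∈ nhdsWithin (1 : ℝ) (Set.Iio 1) :=
      Ioo_mem_nhdsLT (by norm_num)
    filter_upwards [this] with k hk
    exact aux_wirt_k u u' a k hk.1 hk.2 hu hu' ha hb
  simpa using this

lemma aux_wirtC (Y X : ℝ → ℂ) (a : ℝ)
    (hY : ∀ t, HasDerivAt Y (X t) t) (hX : Continuous X)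
    (ha : Y a = 0) (hb : Y (a + π) = 0) :
    ∫ t in a..(a + π), Complex.normSq (Y t) ≤ ∫ t in a..(a + π), Complex.normSq (X t) := by
  have hYc : Continuous Y := continuous_iff_continuousAt.2 fun t => (hY t).continuousAt
  have hre : ∀ t, HasDerivAt (fun s => (Y s).re) (X t).re t := fun t => 
    (Complex.reCLM.hasFDerivAt.comp_hasDerivAt t (hY t))
  have him : ∀ t, HasDerivAt (fun s => (Y s).im) (X t).im t := fun t => 
    (Complex.imCLM.hasFDerivAt.comp_hasDerivAt t (hY t))
  have h1 := aux_wirt _ _ a hre (Complex.continuous_re.comp hX) (by simp [ha]) (by simp [hb])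
  have h2 := aux_wirt _ _ a him (Complex.continuous_im.comp hX) (by simp [ha]) (by simp [hb])
  have e : ∀ Z : ℝ → ℂ, Continuous Z → ∫ t in a..(a + π), Complex.normSq (Z t) =
      (∫ t in a..(a + π), (Z t).re ^ 2) + ∫ t in a..(a + π), (Z t).im ^ 2 := by
    intro Z hZ
    rw [← intervalIntegral.integral_add]
    · congr 1; ext t; rw [Complex.normSq_apply]; ring
    · exact ((Complex.continuous_re.comp hZ).pow 2).intervalIntegrable _ _
    · exact ((Complex.continuous_im.comp hZ).pow 2).intervalIntegrable _ _
  rw [e Y hYc, e X hX]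
  exact add_le_add h1 h2

lemma aux_pair (ρ : ℝ → ℝ) (hρ : Continuous ρ) (ω : ℂ) (hω : ‖ω‖ = 1) (b₁ b₂ : ℝ)
    (X₁ Y₁ X₂ Y₂ : ℝ → ℂ)
    (hY₁ : ∀ t, HasDerivAt Y₁ (X₁ t) t)
    (hX₁ : ∀ t, HasDerivAt X₁ (((b₁ * ρ t - 1 : ℝ) : ℂ) * Y₁ t) t)
    (hY₂ : ∀ t, HasDerivAt Y₂ (X₂ t) t)
    (hX₂ : ∀ t, HasDerivAt X₂ (((b₂ * ρ t - 1 : ℝ) : ℂ) * Y₂ t) t)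
    (q2 : Y₁ (2 * π) = ω * Y₁ 0)
    (q3 : X₂ (2 * π) = ω * X₂ 0) :
    ∫ t in (0 : ℝ)..(2 * π), (Y₁ t * star (Y₂ t) - X₁ t * star (X₂ t)) =
      b₂ * ∫ t in (0 : ℝ)..(2 * π), ((ρ t : ℝ) : ℂ) * (Y₁ t * star (Y₂ t)) := by
  have c1 : Continuous Y₁ := continuous_iff_continuousAt.2 fun t => (hY₁ t).continuousAt
  have c2 : Continuous X₁ := continuous_iff_continuousAt.2 fun t => (hX₁ t).continuousAt
  have c3 : Continuous Y₂ := continuous_iff_continuousAt.2 fun t => (hY₂ t).continuousAt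
  have c4 : Continuous X₂ := continuous_iff_continuousAt.2 fun t => (hX₂ t).continuousAt
  have hww : ω * star ω = 1 := by
    have := Complex.mul_conj ω
    rw [Complex.normSq_eq_norm_sq, hω] at this
    simpa using this
  have hd : ∀ t ∈ Set.uIcc (0 : ℝ) (2 * π), HasDerivAt (fun s => Y₁ s * star (X₂ s))
      (X₁ t * star (X₂ t) + Y₁ t * star (((b₂ * ρ t - 1 : ℝ) : ℂ) * Y₂ t)) t := by
    intro t _
    exact (hY₁ t).mul (hX₂ t).star
  have hcr : Continuous (fun t => ((ρ t : ℝ) : ℂ)) := Complex.continuous_ofReal.comp hρ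
  have hc : Continuous (fun t => X₁ t * star (X₂ t) +
      Y₁ t * star (((b₂ * ρ t - 1 : ℝ) : ℂ) * Y₂ t)) := by
    have : Continuous (fun t => ((b₂ * ρ t - 1 : ℝ) : ℂ)) := by
      apply Complex.continuous_ofReal.comp; fun_prop
    fun_prop
  have h0 := intervalIntegral.integral_eq_sub_of_hasDerivAt hd (hc.intervalIntegrable _ _)
  have h1 : Y₁ (2 * π) * star (X₂ (2 * π)) - Y₁ 0 * star (X₂ 0) = 0 := by
    rw [q2, q3, star_mul]
    linear_combination (Y₁ 0 * star (X₂ 0)) * hww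
  rw [h1] at h0
  have hi1 : Continuous (fun t => Y₁ t * star (Y₂ t) - X₁ t * star (X₂ t)) := by fun_prop
  rw [← intervalIntegral.integral_const_mul, ← sub_eq_zero, ← intervalIntegral.integral_sub
    (hi1.intervalIntegrable _ _) (Continuous.intervalIntegrable (by fun_prop) _ _), ← neg_eq_zero,
    ← intervalIntegral.integral_neg, ← h0]
  congr 1
  ext t
  simp only [star_mul, Complex.star_def, Complex.conj_ofReal]
  push_cast
  ring

lemma aux_upper (ρ : ℝ → ℝ) (hρ : Continuous ρ) (hρ0 : ∀ t, 0 < ρ t) (ω : ℂ) (hω : ‖ω‖ = 1)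
    (T : Finset ℝ) (hT : ∀ b ∈ T, 0 < b) (X Y : ℝ → ℝ → ℂ)
    (hY : ∀ b ∈ T, ∀ t, HasDerivAt (Y b) (X b t) t)
    (hX : ∀ b ∈ T, ∀ t, HasDerivAt (X b) (((b * ρ t - 1 : ℝ) : ℂ) * Y b t) t)
    (qX : ∀ b ∈ T, X b (2 * π) = ω * X b 0) (qY : ∀ b ∈ T, Y b (2 * π) = ω * Y b 0)
    (h0 : ∑ b ∈ T, Y b 0 = 0) (hp : ∑ b ∈ T, Y b π = 0) :
    ∀ b ∈ T, ∀ t ∈ Set.Icc (0 : ℝ) (2 * π), Y b t = 0 := by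
  have hπ := Real.pi_pos
  have cY : ∀ b ∈ T, Continuous (Y b) :=
    fun b hb => continuous_iff_continuousAt.2 fun t => (hY b hb t).continuousAt
  have cX : ∀ b ∈ T, Continuous (X b) :=
    fun b hb => continuous_iff_continuousAt.2 fun t => (hX b hb t).continuousAt
  have hcr : Continuous (fun t => ((ρ t : ℝ) : ℂ)) := Complex.continuous_ofReal.comp hρ
  set P : ℝ → ℝ → ℂ := fun b c =>
    ∫ t in (0 : ℝ)..(2 * π), (Y b t * star (Y c t) - X b t * star (X c t)) with hP
  set W : ℝ → ℝ → ℂ := fun b c =>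
    ∫ t in (0 : ℝ)..(2 * π), ((ρ t : ℝ) : ℂ) * (Y b t * star (Y c t)) with hW
  have hPW : ∀ b ∈ T, ∀ c ∈ T, P b c = c * W b c := fun b hb c hc =>
    aux_pair ρ hρ ω hω b c _ _ _ _ (hY b hb) (hX b hb) (hY c hc) (hX c hc)
      (qY b hb) (qX c hc)
  have hconj : ∀ (f g : ℝ → ℂ), (∀ t, g t = star (f t)) →
      ∫ t in (0 : ℝ)..(2 * π), g t = star (∫ t in (0 : ℝ)..(2 * π), f t) := by
    intro f g h
    rw [show g = fun t => (starRingEnd ℂ) (f t) from funext h]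
    rw [intervalIntegral.intervalIntegral_eq_integral_uIoc, intervalIntegral.intervalIntegral_eq_integral_uIoc, integral_conj]
    simp [hπ.le]
  have hPs : ∀ b c, P c b = star (P b c) := fun b c => hconj _ _ fun t => by
    simp only [star_sub, star_mul, star_star]
  have hWs : ∀ b c, W c b = star (W b c) := fun b c => hconj _ _ fun t => by
    simp only [star_mul, Complex.star_def, Complex.conj_ofReal]
    simp [mul_comm]
  have hoff : ∀ b ∈ T, ∀ c ∈ T, b ≠ c → P b c = 0 := by
    intro b hb c hc hbc
    have e1 := hPW b hb c hc
    have e2 := hPW c hc b hb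
    rw [hPs b c, hWs b c] at e2
    have e3 : P b c = b * W b c := by
      have := congrArg star e2
      simpa [mul_comm] using this
    have e4 : ((b : ℂ) - c) * W b c = 0 := by linear_combination e1 - e3
    have e5 : (b : ℂ) - c ≠ 0 := by
      rw [sub_ne_zero]; exact_mod_cast hbc
    rw [e1, (mul_eq_zero.1 e4).resolve_left e5, mul_zero]
  have hWd : ∀ b, W b b = ((∫ t in (0 : ℝ)..(2 * π), ρ t * Complex.normSq (Y b t) : ℝ) : ℂ) := by
    intro b
    rw [← intervalIntegral.integral_ofReal]
    simp only [hW]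
    congr 1
    ext t
    rw [Complex.ofReal_mul, ← Complex.mul_conj]; rfl
  have hcW : ∀ b ∈ T, Continuous (fun t => ρ t * Complex.normSq (Y b t)) := fun b hb =>
    hρ.mul (Complex.continuous_normSq.comp (cY b hb))
  set Ys : ℝ → ℂ := fun t => ∑ b ∈ T, Y b t with hYs
  set Xs : ℝ → ℂ := fun t => ∑ b ∈ T, X b t with hXs
  have hYd : ∀ t, HasDerivAt Ys (Xs t) t := fun t => HasDerivAt.fun_sum fun b hb => hY b hb t
  have hXc : Continuous Xs := continuous_finsetSum _ fun b hb => cX b hb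
  have hYc : Continuous Ys := continuous_finsetSum _ fun b hb => cY b hb
  have w1 := aux_wirtC Ys Xs 0 hYd hXc h0 (by simpa using hp)
  have h2p : Ys (π + π) = 0 := by
    rw [← two_mul, hYs]
    simp only
    rw [Finset.sum_congr rfl qY, ← Finset.mul_sum, h0, mul_zero]
  have w2 := aux_wirtC Ys Xs π hYd hXc hp h2p
  rw [zero_add] at w1
  have cYn : Continuous fun t => Complex.normSq (Ys t) := Complex.continuous_normSq.comp hYc
  have cXn : Continuous fun t => Complex.normSq (Xs t) := Complex.continuous_normSq.comp hXc
  have w3 : ∫ t in (0 : ℝ)..(2 * π), (Complex.normSq (Ys t) - Complex.normSq (Xs t)) ≤ 0 := by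
    rw [intervalIntegral.integral_sub (cYn.intervalIntegrable _ _) (cXn.intervalIntegrable _ _),
      ← intervalIntegral.integral_add_adjacent_intervals (cYn.intervalIntegrable 0 π)
        (cYn.intervalIntegrable π (2 * π)),
      ← intervalIntegral.integral_add_adjacent_intervals (cXn.intervalIntegrable 0 π)
        (cXn.intervalIntegrable π (2 * π)), two_mul]
    linarith
  have hsum : ((∫ t in (0 : ℝ)..(2 * π), (Complex.normSq (Ys t) - Complex.normSq (Xs t)) : ℝ) : ℂ)
      = ∑ b ∈ T, ∑ c ∈ T, P b c := by
    have s1 : ∀ b ∈ T, ∑ c ∈ T, P b c = ∫ t in (0 : ℝ)..(2 * π),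
        ∑ c ∈ T, (Y b t * star (Y c t) - X b t * star (X c t)) := by
      intro b hb
      rw [intervalIntegral.integral_finsetSum]
      intro c hc
      apply Continuous.intervalIntegrable
      have := cY b hb
      have := cY c hc
      have := cX b hb
      have := cX c hc
      fun_prop
    rw [Finset.sum_congr rfl s1, ← intervalIntegral.integral_finsetSum,
      ← intervalIntegral.integral_ofReal]
    · congr 1
      ext t
      push_cast
      rw [← Complex.mul_conj, ← Complex.mul_conj]
      simp only [hYs, hXs, map_sum, Finset.sum_mul_sum, Finset.sum_sub_distrib]
      rfl
    · intro b hb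
      apply Continuous.intervalIntegrable
      apply continuous_finsetSum
      intro c hc
      have := cY b hb
      have := cY c hc
      have := cX b hb
      have := cX c hc
      fun_prop
  have hdiag : ∑ b ∈ T, ∑ c ∈ T, P b c =
      ((∑ b ∈ T, b * ∫ t in (0 : ℝ)..(2 * π), ρ t * Complex.normSq (Y b t) : ℝ) : ℂ) := by
    rw [Complex.ofReal_sum]
    apply Finset.sum_congr rfl
    intro b hb
    rw [Finset.sum_eq_single_of_mem b hb (fun c hc hcb => hoff b hb c hc hcb.symm),
      hPW b hb b hb, hWd, Complex.ofReal_mul]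
  rw [hdiag] at hsum
  have hsum' := Complex.ofReal_injective hsum
  rw [hsum'] at w3
  have hnn : ∀ b ∈ T, 0 ≤ b * ∫ t in (0 : ℝ)..(2 * π), ρ t * Complex.normSq (Y b t) := by
    intro b hb
    apply mul_nonneg (hT b hb).le
    apply intervalIntegral.integral_nonneg (by linarith)
    intro t _
    exact mul_nonneg (hρ0 t).le (Complex.normSq_nonneg _)
  have hz := (Finset.sum_eq_zero_iff_of_nonneg hnn).1 (le_antisymm w3 (Finset.sum_nonneg hnn))
  intro b hb t ht
  by_contra hne
  have hpos : 0 < ∫ t in (0 : ℝ)..(2 * π), ρ t * Complex.normSq (Y b t) := by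
    apply intervalIntegral.integral_pos (by linarith) (hcW b hb).continuousOn
    · intro s _
      exact mul_nonneg (hρ0 s).le (Complex.normSq_nonneg _)
    · exact ⟨t, ht, mul_pos (hρ0 t) (Complex.normSq_pos.2 hne)⟩
  have := mul_pos (hT b hb) hpos
  rw [hz b hb] at this
  exact lt_irrefl _ this

/-- Scalar form of the linear system. -/
def AuxSol (β e : ℝ) (x y : ℝ → ℝ) : Prop :=
  (∀ t, HasDerivAt x ((β * (1 + e * Real.cos t)⁻¹ - 1) * y t) t) ∧ ∀ t, HasDerivAt y (x t) t

lemma aux_fund {β e : ℝ} {γ : ℝ → Matrix (Fin 2) (Fin 2) ℝ} (h : IsFundSol β e γ) (j : Fin 2) :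
    AuxSol β e (fun t => γ t 0 j) (fun t => γ t 1 j) := by
  constructor
  · intro t
    refine (h.2 t 0 j).congr_deriv ?_
    simp [Jmat, Bmat, Matrix.mul_apply, Fin.sum_univ_two]
    left
    ring
  · intro t
    refine (h.2 t 1 j).congr_deriv ?_
    simp [Jmat, Bmat, Matrix.mul_apply, Fin.sum_univ_two]

lemma aux_wronsk {β e : ℝ} {x y x' y' : ℝ → ℝ} (h : AuxSol β e x y) (h' : AuxSol β e x' y')
    (t : ℝ) : x t * y' t - x' t * y t = x 0 * y' 0 - x' 0 * y 0 := by
  have hd : ∀ t, HasDerivAt (fun t => x t * y' t - x' t * y t) 0 t := by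
    intro t
    refine (((h.1 t).mul (h'.2 t)).sub ((h'.1 t).mul (h.2 t))).congr_deriv ?_
    ring
  exact is_const_of_deriv_eq_zero (fun t => (hd t).differentiableAt) (fun t => (hd t).deriv) t 0

lemma aux_det {β e : ℝ} {γ : ℝ → Matrix (Fin 2) (Fin 2) ℝ} (h : IsFundSol β e γ) (t : ℝ) :
    γ t 0 0 * γ t 1 1 - γ t 0 1 * γ t 1 0 = 1 := by
  have := aux_wronsk (aux_fund h 0) (aux_fund h 1) t
  simpa [h.1] using this

lemma aux_rep {β e : ℝ} {γ : ℝ → Matrix (Fin 2) (Fin 2) ℝ} (h : IsFundSol β e γ)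
    {x y : ℝ → ℝ} (hs : AuxSol β e x y) (t : ℝ) :
    x t = γ t 0 0 * x 0 + γ t 0 1 * y 0 ∧ y t = γ t 1 0 * x 0 + γ t 1 1 * y 0 := by
  have h0 := aux_wronsk hs (aux_fund h 0) t
  have h1 := aux_wronsk hs (aux_fund h 1) t
  have hd := aux_det h t
  simp [h.1] at h0 h1
  constructor
  · linear_combination (-x t) * hd + γ t 0 0 * h1 - γ t 0 1 * h0
  · linear_combination (-y t) * hd + γ t 1 0 * h1 - γ t 1 1 * h0

lemma aux_refl {β e : ℝ} {x y : ℝ → ℝ} (hs : AuxSol β e x y) :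
    AuxSol β e (fun t => x (-t)) (fun t => - y (-t)) := by
  constructor
  · intro t
    refine ((hs.1 (-t)).comp t (hasDerivAt_neg t)).congr_deriv ?_
    rw [Real.cos_neg]; ring
  · intro t
    refine ((hs.2 (-t)).comp t (hasDerivAt_neg t)).neg.congr_deriv ?_
    ring

lemma aux_shift {β e : ℝ} {x y : ℝ → ℝ} (hs : AuxSol β e x y) :
    AuxSol β e (fun t => x (t + 2 * π)) (fun t => y (t + 2 * π)) := by
  constructor
  · intro t
    refine ((hs.1 (t + 2 * π)).comp_add_const t (2 * π)).congr_deriv ?_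
    rw [Real.cos_add_two_pi]
  · intro t
    exact (hs.2 (t + 2 * π)).comp_add_const t (2 * π)

lemma aux_mono {β e : ℝ} {γ : ℝ → Matrix (Fin 2) (Fin 2) ℝ} (h : IsFundSol β e γ) :
    γ (2 * π) 0 0 = 2 * (γ π 0 0 * γ π 1 1) - 1 ∧ γ (2 * π) 1 1 = 2 * (γ π 0 0 * γ π 1 1) - 1 ∧
    γ (2 * π) 1 0 = 2 * (γ π 0 0 * γ π 1 0) ∧ γ (2 * π) 0 1 = 2 * (γ π 0 1 * γ π 1 1) := by
  have hd := aux_det h π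
  have r0 := aux_rep h (aux_refl (aux_fund h 0)) π
  have r1 := aux_rep h (aux_refl (aux_fund h 1)) π
  have s0 := aux_rep h (aux_shift (aux_fund h 0)) (-π)
  have s1 := aux_rep h (aux_shift (aux_fund h 1)) (-π)
  have e : -π + 2 * π = π := by ring
  simp [h.1] at r0 r1
  simp only [e, zero_add] at s0 s1
  obtain ⟨r00, r01⟩ := r0
  obtain ⟨r10, r11⟩ := r1
  have r01' : γ (-π) 1 0 = - γ π 1 0 := by linarith
  obtain ⟨s00, s01⟩ := s0
  obtain ⟨s10, s11⟩ := s1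
  rw [r00, r10] at s00 s10
  rw [r01', r11] at s01 s11
  set p := γ π 0 0
  set q := γ π 0 1
  set r := γ π 1 0
  set s := γ π 1 1
  set A := γ (2 * π) 0 0
  set B := γ (2 * π) 1 0
  set C := γ (2 * π) 0 1
  set D := γ (2 * π) 1 1
  refine ⟨?_, ?_, ?_, ?_⟩
  · linear_combination (-A - 1) * hd - s * s00 - q * s01
  · linear_combination (-D - 1) * hd - r * s10 - p * s11
  · linear_combination (-B) * hd - r * s00 - p * s01
  · linear_combination (-C) * hd - s * s10 - q * s11

lemma aux_zero {e : ℝ} {γ : ℝ → Matrix (Fin 2) (Fin 2) ℝ} (h : IsFundSol 0 e γ) :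
    γ π 0 0 = -1 ∧ γ π 1 1 = -1 := by
  have s1 : AuxSol 0 e Real.cos Real.sin := by
    constructor
    · intro t
      refine (Real.hasDerivAt_cos t).congr_deriv ?_
      ring
    · intro t
      exact Real.hasDerivAt_sin t
  have s2 : AuxSol 0 e (fun t => -Real.sin t) Real.cos := by
    constructor
    · intro t
      refine (Real.hasDerivAt_sin t).neg.congr_deriv ?_
      ring
    · intro t
      exact Real.hasDerivAt_cos t
  have h1 := aux_rep h s1 π
  have h2 := aux_rep h s2 π
  simp at h1 h2
  exact ⟨h1.1.symm, h2.2.symm⟩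

lemma aux_den {e : ℝ} (he : e ∈ Set.Ico (0 : ℝ) 1) (t : ℝ) : 1 - e ≤ 1 + e * Real.cos t := by
  nlinarith [Real.neg_one_le_cos t, he.1]

lemma aux_one {e : ℝ} (he : e ∈ Set.Ico (0 : ℝ) 1)
    {γ : ℝ → Matrix (Fin 2) (Fin 2) ℝ} (h : IsFundSol 1 e γ) :
    0 < γ π 0 0 ∧ 0 < γ π 1 1 ∧ γ π 0 0 * γ π 1 1 = 1 := by
  have he0 := he.1
  have he1 := he.2
  have s1 : AuxSol 1 e (fun t => e * -Real.sin t) (fun t => 1 + e * Real.cos t) := by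
    constructor
    · intro t
      refine ((Real.hasDerivAt_sin t).neg.const_mul e).congr_deriv ?_
      have : 1 + e * Real.cos t ≠ 0 := by linarith [aux_den he t]
      field_simp
      ring
    · intro t
      exact ((Real.hasDerivAt_cos t).const_mul e).const_add 1
  have h1 := aux_rep h s1 π
  have hd := aux_det h π
  simp at h1
  obtain ⟨h1, h2⟩ := h1
  have hq : γ π 0 1 = 0 := by
    rcases h1 with h1 | h1
    · exact h1
    · linarith
  have hs : 0 < γ π 1 1 := by
    by_contra hn
    nlinarith
  rw [hq] at hd
  have hps : γ π 0 0 * γ π 1 1 = 1 := by linarith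
  refine ⟨?_, hs, hps⟩
  by_contra hn
  nlinarith

lemma aux_cont {e : ℝ} (he : e ∈ Set.Ico (0 : ℝ) 1) (γ : ℝ → ℝ → Matrix (Fin 2) (Fin 2) ℝ)
    (hγ : ∀ β ∈ Set.Icc (0 : ℝ) 1, IsFundSol β e (γ β)) (i j : Fin 2) :
    ContinuousOn (fun β => γ β π i j) (Set.Icc (0 : ℝ) 1) := by
  have he0 := he.1
  have he1 := he.2
  intro b hb
  have hsb := aux_fund (hγ b hb) j
  have hyc : Continuous (fun t => γ b t 1 j) :=
    continuous_iff_continuousAt.2 fun t => (hsb.2 t).continuousAt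
  obtain ⟨M, hM⟩ := isCompact_Icc.exists_bound_of_continuousOn
    (hyc.continuousOn (s := Set.Icc (0 : ℝ) π))
  set R : ℝ := (1 - e)⁻¹ with hR
  have hR0 : 0 < R := inv_pos.2 (by linarith)
  have hρ : ∀ t, 0 < (1 + e * Real.cos t)⁻¹ ∧ (1 + e * Real.cos t)⁻¹ ≤ R := by
    intro t
    have := aux_den he t
    exact ⟨inv_pos.2 (by linarith), inv_anti₀ (by linarith) this⟩
  have key : ∀ β ∈ Set.Icc (0 : ℝ) 1, dist (γ β π i j) (γ b π i j) ≤
      gronwallBound 0 (1 + R) (|β - b| * (R * M)) π := by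
    intro β hβ
    have hs := aux_fund (hγ β hβ) j
    set f : ℝ → ℝ × ℝ := fun t => (γ β t 0 j - γ b t 0 j, γ β t 1 j - γ b t 1 j) with hf
    set f' : ℝ → ℝ × ℝ := fun t =>
      ((β * (1 + e * Real.cos t)⁻¹ - 1) * γ β t 1 j - (b * (1 + e * Real.cos t)⁻¹ - 1) * γ b t 1 j,
        γ β t 0 j - γ b t 0 j) with hf'
    have hfd : ∀ t, HasDerivAt f (f' t) t := fun t =>
      ((hs.1 t).sub (hsb.1 t)).prodMk ((hs.2 t).sub (hsb.2 t))
    have hg := norm_le_gronwallBound_of_norm_deriv_right_le (f := f) (f' := f') (δ := 0)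
      (K := 1 + R) (ε := |β - b| * (R * M)) (a := 0) (b := π)
      (fun t _ => (hfd t).continuousAt.continuousWithinAt)
      (fun t _ => (hfd t).hasDerivWithinAt)
      (by simp [hf, (hγ β hβ).1, (hγ b hb).1]) ?_ π ⟨Real.pi_pos.le, le_rfl⟩
    · rw [sub_zero] at hg
      refine le_trans ?_ hg
      rw [Real.dist_eq, ← Real.norm_eq_abs]
      fin_cases i
      · exact norm_fst_le (f π)
      · exact norm_snd_le (f π)
    · intro t ht
      have hMt := hM t ⟨ht.1, ht.2.le⟩
      have n1 := norm_fst_le (f t)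
      have n2 := norm_snd_le (f t)
      simp only [hf, Real.norm_eq_abs] at n1 n2 hMt
      have hM0 : 0 ≤ M := (abs_nonneg _).trans hMt
      have hfn := norm_nonneg (f t)
      obtain ⟨ρ0, ρR⟩ := hρ t
      set ρ := (1 + e * Real.cos t)⁻¹
      rw [Prod.norm_def]
      apply max_le
      · simp only [hf', Real.norm_eq_abs]
        have e1 : (β * ρ - 1) * γ β t 1 j - (b * ρ - 1) * γ b t 1 j =
          (β * ρ - 1) * (γ β t 1 j - γ b t 1 j) + (β - b) * (ρ * γ b t 1 j) := by ring
        rw [e1]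
        refine (abs_add_le _ _).trans ?_
        rw [abs_mul, abs_mul, abs_mul]
        have e2 : |β * ρ - 1| ≤ 1 + R := by
          rw [abs_le]
          constructor
          · nlinarith [hβ.1, mul_nonneg hβ.1 ρ0.le]
          · nlinarith [hβ.2, mul_nonneg hβ.1 ρ0.le]
        have e3 : |ρ| ≤ R := by rw [abs_of_pos ρ0]; exact ρR
        gcongr
      · simp only [hf', Real.norm_eq_abs]
        have : 0 ≤ |β - b| * (R * M) := by positivity
        nlinarith
  rw [ContinuousWithinAt, tendsto_iff_dist_tendsto_zero]
  have hlim : Filter.Tendsto (fun β => gronwallBound 0 (1 + R) (|β - b| * (R * M)) π)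
      (nhdsWithin b (Set.Icc 0 1)) (nhds 0) := by
    have hc : Continuous (fun β : ℝ => gronwallBound 0 (1 + R) (|β - b| * (R * M)) π) :=
      (gronwallBound_continuous_ε 0 (1 + R) π).comp
        (g := fun ε => gronwallBound 0 (1 + R) ε π) (f := fun β : ℝ => |β - b| * (R * M))
        (by fun_prop)
    have := (hc.tendsto b).mono_left (nhdsWithin_le_nhds (s := Set.Icc (0 : ℝ) 1))
    simpa [gronwallBound_ε0_δ0] using this
  refine squeeze_zero' (Filter.Eventually.of_forall fun _ => dist_nonneg) ?_ hlim
  filter_upwards [self_mem_nhdsWithin] with β hβ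
  exact key β hβ

lemma aux_detC {β e : ℝ} {γ : ℝ → Matrix (Fin 2) (Fin 2) ℝ} (h : IsFundSol β e γ)
    (ω : ℂ) (hω : ‖ω‖ = 1) :
    Matrix.det ((γ (2 * π)).map (fun x => (x : ℂ)) - ω • 1) = 0 ↔
      2 * (γ π 0 0 * γ π 1 1) - 1 = ω.re := by
  obtain ⟨hA, hD, -, -⟩ := aux_mono h
  have hd := aux_det h (2 * π)
  have hdC : (γ (2 * π) 0 0 : ℂ) * γ (2 * π) 1 1 - γ (2 * π) 0 1 * γ (2 * π) 1 0 = 1 := by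
    exact_mod_cast hd
  have hww : ω * (starRingEnd ℂ) ω = 1 := by
    have := Complex.mul_conj ω
    rw [Complex.normSq_eq_norm_sq, hω] at this
    simpa using this
  have hw0 : ω ≠ 0 := by
    intro h0; rw [h0] at hω; simp at hω
  have hre : ω + (starRingEnd ℂ) ω = ((2 * ω.re : ℝ) : ℂ) := Complex.add_conj ω
  have hAC : (γ (2 * π) 0 0 : ℂ) = ((2 * (γ π 0 0 * γ π 1 1) - 1 : ℝ) : ℂ) := by rw [hA]
  have hDC : (γ (2 * π) 1 1 : ℂ) = ((2 * (γ π 0 0 * γ π 1 1) - 1 : ℝ) : ℂ) := by rw [hD]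
  set f : ℝ := 2 * (γ π 0 0 * γ π 1 1) - 1
  have hdet : Matrix.det ((γ (2 * π)).map (fun x => (x : ℂ)) - ω • 1) =
      ω * ((2 * (ω.re - f) : ℝ) : ℂ) := by
    rw [Matrix.det_fin_two]
    simp
    simp only [Complex.ofReal_mul, Complex.ofReal_ofNat] at hre
    linear_combination hdC + ω * hre - hww - ω * hAC - ω * hDC
  rw [hdet, mul_eq_zero, or_iff_right hw0, Complex.ofReal_eq_zero]
  constructor
  · intro h; linarith
  · intro h; rw [h]; ring

lemma aux_upper_fin (e : ℝ) (he : e ∈ Set.Ico (0 : ℝ) 1)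
    (ω : ℂ) (hω : ‖ω‖ = 1) (γ : ℝ → ℝ → Matrix (Fin 2) (Fin 2) ℝ)
    (T : Finset ℝ) (hT : ∀ b ∈ T, 0 < b) (hγ : ∀ β ∈ T, IsFundSol β e (γ β)) :
    ∑ β ∈ T, Module.finrank ℂ (LinearMap.ker (Matrix.toLin'
          ((γ β (2 * π)).map (fun x => (x : ℂ)) - ω • 1))) ≤ 2 := by
  have hπ := Real.pi_pos
  set K : ℝ → Submodule ℂ (Fin 2 → ℂ) := fun β => LinearMap.ker (Matrix.toLin'
          ((γ β (2 * π)).map (fun x => (x : ℂ)) - ω • 1)) with hK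
  by_contra hlt
  push Not at hlt
  have hfr : Module.finrank ℂ ((b : T) → K b) = ∑ β ∈ T, Module.finrank ℂ (K β) := by
    rw [Module.finrank_pi_fintype]
    exact Finset.sum_coe_sort T (fun b => Module.finrank ℂ (K b))
  let ev : ℝ → ((b : T) → K b) →ₗ[ℂ] ℂ := fun t =>
    ∑ b : T, (LinearMap.proj 1) ∘ₗ (Matrix.toLin' ((γ b t).map (fun x => (x : ℂ)))) ∘ₗ
      (K b).subtype ∘ₗ (LinearMap.proj b)
  let L : ((b : T) → K b) →ₗ[ℂ] (Fin 2 → ℂ) := LinearMap.pi ![ev 0, ev π]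
  have hker : LinearMap.ker L ≠ ⊥ := by
    apply LinearMap.ker_ne_bot_of_finrank_lt
    rw [hfr]
    simpa using hlt
  obtain ⟨v, hv, hv0⟩ := (Submodule.ne_bot_iff _).1 hker
  apply hv0
  set w : ℝ → Fin 2 → ℂ := fun b => if h : b ∈ T then (v ⟨b, h⟩ : Fin 2 → ℂ) else 0 with hw
  have hwv : ∀ b : T, w b = (v b : Fin 2 → ℂ) := by
    intro b; simp [hw]
  set X : ℝ → ℝ → ℂ := fun b t => γ b t 0 0 * w b 0 + γ b t 0 1 * w b 1 with hX
  set Y : ℝ → ℝ → ℂ := fun b t => γ b t 1 0 * w b 0 + γ b t 1 1 * w b 1 with hY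
  have hev : ∀ t, ev t v = ∑ b ∈ T, Y b t := by
    intro t
    rw [← Finset.sum_coe_sort T (fun b => Y b t)]
    simp only [ev, LinearMap.sum_apply]
    apply Finset.sum_congr rfl
    intro b _
    simp [hY, hwv, Matrix.mulVec, dotProduct, Fin.sum_univ_two]
  have hL : ∀ i, L v i = 0 := by
    intro i
    rw [LinearMap.mem_ker.1 hv]; rfl
  have h0 : ∑ b ∈ T, Y b 0 = 0 := by rw [← hev]; exact hL 0
  have hp : ∑ b ∈ T, Y b π = 0 := by rw [← hev]; exact hL 1
  have hq : ∀ b ∈ T, X b (2 * π) = ω * X b 0 ∧ Y b (2 * π) = ω * Y b 0 := by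
    intro b hb
    have hm : w b ∈ K b := by
      have := hwv ⟨b, hb⟩
      simp only at this
      rw [this]
      exact (v ⟨b, hb⟩).2
    rw [hK, LinearMap.mem_ker] at hm
    have m0 := congrFun hm 0
    have m1 := congrFun hm 1
    simp at m0 m1
    simp only [hX, hY, (hγ b hb).1]
    simp
    constructor
    · linear_combination m0
    · linear_combination m1
  have hdr : ∀ b ∈ T, ∀ t, HasDerivAt (Y b) (X b t) t := by
    intro b hb t
    have a0 := ((aux_fund (hγ b hb) 0).2 t).ofReal_comp
    have a1 := ((aux_fund (hγ b hb) 1).2 t).ofReal_comp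
    exact (a0.mul_const (w b 0)).add (a1.mul_const (w b 1))
  have hρ0 : ∀ t, 0 < (1 + e * Real.cos t)⁻¹ := by
    intro t
    exact inv_pos.2 (by linarith [aux_den he t, he.2])
  have hz := aux_upper (fun t => (1 + e * Real.cos t)⁻¹)
    (Continuous.inv₀ (by fun_prop) (fun t => (inv_pos.1 (hρ0 t)).ne')) hρ0 ω hω T hT X Y
    hdr ?_ (fun b hb => (hq b hb).1) (fun b hb => (hq b hb).2) h0 hp
  · funext b
    have hz' := hz b b.2
    have hev0 : Y b =ᶠ[nhds π] fun _ => 0 := by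
      have : Set.Icc (0 : ℝ) (2 * π) ∈ nhds π := Icc_mem_nhds hπ (by linarith)
      filter_upwards [this] with t ht
      exact hz' t ht
    have hXπ : X b π = 0 := (hdr b b.2 π).unique ((hasDerivAt_const π (0 : ℂ)).congr_of_eventuallyEq hev0)
    have hYπ : Y b π = 0 := hz' π ⟨hπ.le, by linarith⟩
    have hd := aux_det (hγ b b.2) π
    have hdC : (γ b π 0 0 : ℂ) * γ b π 1 1 - γ b π 0 1 * γ b π 1 0 = 1 := by
      exact_mod_cast hd
    simp only [hX, hY] at hXπ hYπ
    apply Subtype.ext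
    rw [← hwv]
    funext i
    fin_cases i
    · change w b 0 = 0
      linear_combination (-w b 0) * hdC + (γ b π 1 1 : ℂ) * hXπ - (γ b π 0 1 : ℂ) * hYπ
    · change w b 1 = 0
      linear_combination (-w b 1) * hdC - (γ b π 1 0 : ℂ) * hXπ + (γ b π 0 0 : ℂ) * hYπ
  · intro b hb t
    have a0 := ((aux_fund (hγ b hb) 0).1 t).ofReal_comp
    have a1 := ((aux_fund (hγ b hb) 1).1 t).ofReal_comp
    refine ((a0.mul_const (w b 0)).add (a1.mul_const (w b 1))).congr_deriv ?_
    simp only [hY]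
    push_cast
    ring
/-- for fixed `e ∈ [0,1)` and `ω ∈ 𝕌 \ {1}`, the set of `β ∈ [0,1]` at which
`γ_{β,e}(2π)` is `ω`-degenerate is a finite subset of `(0,1)`, with total multiplicity 2. -/
theorem stmt_6 (e : ℝ) (he : e ∈ Set.Ico (0 : ℝ) 1)
    (ω : ℂ) (hω : ‖ω‖ = 1) (hω1 : ω ≠ 1)
    (γ : ℝ → ℝ → Matrix (Fin 2) (Fin 2) ℝ)
    (hγ : ∀ β ∈ Set.Icc (0 : ℝ) 1, IsFundSol β e (γ β)) :
    (Set.Finite {β ∈ Set.Icc (0 : ℝ) 1 |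
        Matrix.det ((γ β (2 * π)).map (fun x => (x : ℂ)) - ω • 1) = 0}) ∧
    {β ∈ Set.Icc (0 : ℝ) 1 |
        Matrix.det ((γ β (2 * π)).map (fun x => (x : ℂ)) - ω • 1) = 0} ⊆ Set.Ioo 0 1 ∧
    ∑ᶠ β ∈ {β ∈ Set.Icc (0 : ℝ) 1 |
        Matrix.det ((γ β (2 * π)).map (fun x => (x : ℂ)) - ω • 1) = 0},
      Module.finrank ℂ
        (LinearMap.ker (Matrix.toLin'
          ((γ β (2 * π)).map (fun x => (x : ℂ)) - ω • 1))) = 2 := by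
  set S : Set ℝ := {β ∈ Set.Icc (0 : ℝ) 1 |
        Matrix.det ((γ β (2 * π)).map (fun x => (x : ℂ)) - ω • 1) = 0} with hS
  set d : ℝ → ℕ := fun β => Module.finrank ℂ
        (LinearMap.ker (Matrix.toLin'
          ((γ β (2 * π)).map (fun x => (x : ℂ)) - ω • 1))) with hd
  set f : ℝ → ℝ := fun β => 2 * (γ β π 0 0 * γ β π 1 1) - 1 with hf
  have hmem : ∀ β ∈ Set.Icc (0 : ℝ) 1, β ∈ S ↔ f β = ω.re := by
    intro β hβ
    rw [← aux_detC (hγ β hβ) ω hω]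
    exact ⟨fun h => h.2, fun h => ⟨hβ, h⟩⟩
  have m0 : (0 : ℝ) ∈ Set.Icc (0 : ℝ) 1 := by simp
  have m1 : (1 : ℝ) ∈ Set.Icc (0 : ℝ) 1 := by simp
  obtain ⟨p0, s0⟩ := aux_zero (hγ 0 m0)
  obtain ⟨p1, s1, ps1⟩ := aux_one he (hγ 1 m1)
  have hf0 : f 0 = 1 := by simp only [hf, p0, s0]; norm_num
  have hf1 : f 1 = 1 := by simp only [hf, ps1]; norm_num
  have hsq : ω.re ^ 2 + ω.im ^ 2 = 1 := by
    have h1 := Complex.normSq_eq_norm_sq ω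
    rw [hω, Complex.normSq_apply] at h1
    linarith
  have hre1 : ω.re < 1 := by
    by_contra hn
    push Not at hn
    have h2 : ω.re = 1 := by nlinarith [sq_nonneg ω.im]
    have h3 : ω.im = 0 := by
      have : ω.im ^ 2 = 0 := by rw [h2] at hsq; linarith
      exact pow_eq_zero_iff (two_ne_zero) |>.1 this
    exact hω1 (Complex.ext h2 h3)
  have hre2 : -1 ≤ ω.re := by nlinarith [sq_nonneg ω.im]
  have hsub : S ⊆ Set.Ioo 0 1 := by
    intro β hβ
    have h1 := (hmem β hβ.1).1 hβ
    refine ⟨lt_of_le_of_ne hβ.1.1 ?_, lt_of_le_of_ne hβ.1.2 ?_⟩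
    · intro h; rw [← h, hf0] at h1; linarith
    · intro h; rw [h, hf1] at h1; linarith
  have hup : ∀ T : Finset ℝ, (T : Set ℝ) ⊆ S → ∑ β ∈ T, d β ≤ 2 := by
    intro T hT
    exact aux_upper_fin e he ω hω γ T (fun b hb => (hsub (hT hb)).1)
      (fun b hb => hγ b (hT hb).1)
  have hpos : ∀ β ∈ S, 1 ≤ d β := by
    intro β hβ
    obtain ⟨v, hv, hv0⟩ := Matrix.exists_mulVec_eq_zero_iff.2 hβ.2
    apply Submodule.one_le_finrank_iff.2
    rw [Submodule.ne_bot_iff]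
    exact ⟨v, by rw [LinearMap.mem_ker, Matrix.toLin'_apply]; exact hv0, hv⟩
  have hfin : S.Finite := by
    by_contra hinf
    obtain ⟨T, hT, hcard⟩ := Set.Infinite.exists_subset_card_eq hinf 3
    have h1 := hup T hT
    have h2 : ∑ β ∈ T, 1 ≤ ∑ β ∈ T, d β := Finset.sum_le_sum fun b hb => hpos b (hT hb)
    simp [hcard] at h2
    omega
  have hcp := aux_cont he γ hγ 0 0
  have hcs := aux_cont he γ hγ 1 1
  have hcf : ContinuousOn f (Set.Icc 0 1) :=
    (continuousOn_const.mul (hcp.mul hcs)).sub continuousOn_const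
  obtain ⟨b1, hb1, hb1z⟩ := intermediate_value_Ioo (zero_le_one) hcp
    (show (0 : ℝ) ∈ Set.Ioo _ _ from ⟨by rw [p0]; norm_num, p1⟩)
  obtain ⟨b2, hb2, hb2z⟩ := intermediate_value_Ioo (zero_le_one) hcs
    (show (0 : ℝ) ∈ Set.Ioo _ _ from ⟨by rw [s0]; norm_num, s1⟩)
  simp only at hb1z hb2z
  have hb1' := Set.Ioo_subset_Icc_self hb1
  have hb2' := Set.Ioo_subset_Icc_self hb2
  have hfb1 : f b1 = -1 := by simp only [hf, hb1z]; norm_num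
  have hfb2 : f b2 = -1 := by simp only [hf, hb2z]; norm_num
  have htwo : ∀ a b, a ∈ S → b ∈ S → a ≠ b →
      ∃ T : Finset ℝ, (T : Set ℝ) ⊆ S ∧ 2 ≤ ∑ β ∈ T, d β := by
    intro a b ha hb hab
    refine ⟨{a, b}, ?_, ?_⟩
    · intro x hx
      simp at hx
      rcases hx with rfl | rfl <;> assumption
    · rw [Finset.sum_pair hab]
      have := hpos a ha
      have := hpos b hb
      omega
  have hlow : ∃ T : Finset ℝ, (T : Set ℝ) ⊆ S ∧ 2 ≤ ∑ β ∈ T, d β := by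
    rcases eq_or_lt_of_le hre2 with hm | hm
    · have hS1 : b1 ∈ S := (hmem b1 hb1').2 (by rw [hfb1, hm])
      have hS2 : b2 ∈ S := (hmem b2 hb2').2 (by rw [hfb2, hm])
      by_cases hbb : b1 = b2
      · refine ⟨{b1}, by simpa using hS1, ?_⟩
        rw [Finset.sum_singleton]
        rw [← hbb] at hb2z
        obtain ⟨hA, hD, hB, hC⟩ := aux_mono (hγ b1 hb1')
        rw [hb1z] at hA hD hB
        rw [hb2z] at hC
        have him : ω.im = 0 := by
          have : ω.im ^ 2 = 0 := by rw [← hm] at hsq; linarith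
          exact pow_eq_zero_iff (two_ne_zero) |>.1 this
        have hω' : ω = -1 := Complex.ext (by simp [← hm]) (by simp [him])
        have hMz : (γ b1 (2 * π)).map (fun x => (x : ℂ)) - ω • 1 = 0 := by
          ext i j
          fin_cases i <;> fin_cases j <;> simp [hA, hB, hC, hD, hω']
        simp only [hd]
        rw [hMz, map_zero, LinearMap.ker_zero, finrank_top]
        simp
      · exact htwo b1 b2 hS1 hS2 hbb
    · obtain ⟨c1, hc1, hc1f⟩ := intermediate_value_Ioo' hb1.1.le
        (hcf.mono (Set.Icc_subset_Icc_right hb1.2.le))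
        (show ω.re ∈ Set.Ioo _ _ from ⟨by rw [hfb1]; exact hm, by rw [hf0]; exact hre1⟩)
      obtain ⟨c2, hc2, hc2f⟩ := intermediate_value_Ioo hb1.2.le
        (hcf.mono (Set.Icc_subset_Icc_left hb1.1.le))
        (show ω.re ∈ Set.Ioo _ _ from ⟨by rw [hfb1]; exact hm, by rw [hf1]; exact hre1⟩)
      refine htwo c1 c2 ((hmem c1 ⟨hc1.1.le, (hc1.2.trans hb1.2).le⟩).2 hc1f)
        ((hmem c2 ⟨(hb1.1.trans hc2.1).le, hc2.2.le⟩).2 hc2f) ?_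
      exact (hc1.2.trans hc2.1).ne
  refine ⟨hfin, hsub, ?_⟩
  rw [finsum_mem_eq_finite_toFinset_sum _ hfin]
  apply le_antisymm
  · exact hup _ (by simp)
  · obtain ⟨T, hT, h2⟩ := hlow
    refine h2.trans ?_
    apply Finset.sum_le_sum_of_subset
    intro x hx
    simpa using hT hx
end
end

section
/- For every ω ∈ ℂ with |ω| = 1 and ω ≠ 1, there exist two real-analytic functions β₁(·,ω), β₂(·,ω) : [0,1) → (0,1) such that for every e ∈ [0,1) and every β ∈ [0,1], the monodromy matrix γ_{β,e}(2π) is ω-degenerate (i.e., det(γ_{β,e}(2π) − ω I₂) = 0 over ℂ) if and only if β ∈ {β₁(e,ω), β₂(e,ω)}. -/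
open Real Matrix

attribute [local instance] Matrix.normedAddCommGroup

noncomputable section

open Filter Topology Set in
lemma slope_pos_right {g : ℝ → ℝ} {g' z : ℝ} (h : HasDerivAt g g' z) (hg : 0 < g') :
    (∀ᶠ s in 𝓝[>] z, g z < g s) ∧ (∀ᶠ s in 𝓝[<] z, g s < g z) := by
  have h1 := hasDerivAt_iff_tendsto_slope.1 h
  have h2 : ∀ᶠ s in 𝓝[≠] z, 0 < slope g z s := h1.eventually (lt_mem_nhds hg)
  constructor
  · have h3 : ∀ᶠ s in 𝓝[>] z, 0 < slope g z s :=
      h2.filter_mono (nhdsWithin_mono _ (fun s hs => ne_of_gt hs))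
    filter_upwards [h3, self_mem_nhdsWithin] with s hs hsz
    have hsz' : 0 < s - z := sub_pos.2 hsz
    rw [slope_def_field] at hs
    have := (div_pos_iff_of_pos_right hsz').1 hs
    linarith
  · have h3 : ∀ᶠ s in 𝓝[<] z, 0 < slope g z s :=
      h2.filter_mono (nhdsWithin_mono _ (fun s hs => ne_of_lt hs))
    filter_upwards [h3, self_mem_nhdsWithin] with s hs hsz
    have hsz' : s - z < 0 := sub_neg.2 hsz
    rw [slope_def_field] at hs
    rcases div_pos_iff.1 hs with h | h <;> linarith [h.1, h.2]

open Filter Topology Set in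
lemma first_cross {g g' : ℝ → ℝ} {x y : ℝ} (hd : ∀ z ∈ Icc x y, HasDerivAt g (g' z) z)
    (h : ∀ z ∈ Icc x y, (∀ s ∈ Ioo x z, 0 < g s) → g z = 0 → 0 < g' z) (hx : 0 ≤ g x) :
    ∀ z ∈ Ioc x y, 0 < g z := by
  intro z1 hz1
  by_contra hneg
  push Not at hneg
  have hxy : x ≤ y := hz1.1.le.trans hz1.2
  have hnear : ∀ᶠ s in 𝓝[>] x, 0 < g s := by
    rcases hx.lt_or_eq with hx | hx
    · exact ((hd x ⟨le_rfl, hxy⟩).continuousAt.eventually (lt_mem_nhds hx)).filter_mono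
        nhdsWithin_le_nhds
    · have := h x ⟨le_rfl, hxy⟩ (by simp) hx.symm
      have := (slope_pos_right (hd x ⟨le_rfl, hxy⟩) this).1
      rwa [← hx] at this
  obtain ⟨δ, hδ, hδ'⟩ := mem_nhdsGT_iff_exists_Ioo_subset.1 hnear
  have hδ : x < δ := hδ
  set q := (x + min δ z1) / 2 with hq
  have hm : x < min δ z1 := lt_min hδ hz1.1
  have hxq : x < q := by rw [hq]; linarith
  have hqd : q < δ := by have := min_le_left δ z1; rw [hq]; linarith
  have hqz : q < z1 := by have := min_le_right δ z1; rw [hq]; linarith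
  have hcont : ContinuousOn g (Icc q z1) := fun s hs =>
    (hd s ⟨hxq.le.trans hs.1, hs.2.trans hz1.2⟩).continuousAt.continuousWithinAt
  have hK : IsCompact (Icc q z1 ∩ g ⁻¹' Iic 0) :=
    isCompact_Icc.of_isClosed_subset (hcont.preimage_isClosed_of_isClosed isClosed_Icc isClosed_Iic)
      inter_subset_left
  obtain ⟨t, ht, htl⟩ := hK.exists_isLeast ⟨z1, ⟨hqz.le, le_rfl⟩, hneg⟩
  have hxt : x < t := hxq.trans_le ht.1.1
  have htI : t ∈ Icc x y := ⟨hxt.le, ht.1.2.trans hz1.2⟩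
  have hpos : ∀ s ∈ Ioo x t, 0 < g s := by
    intro s hs
    by_cases hsq : s < δ
    · exact hδ' ⟨hs.1, hsq⟩
    · by_contra hgs
      push Not at hgs hsq
      have := htl ⟨⟨hqd.le.trans hsq, hs.2.le.trans ht.1.2⟩, hgs⟩
      exact absurd hs.2 (not_lt.2 this)
  have hev : ∀ᶠ s in 𝓝[<] t, 0 < g s := by
    filter_upwards [Ioo_mem_nhdsLT hxt] with s hs using hpos s hs
  have hge : 0 ≤ g t := by
    have hc : Tendsto g (𝓝[<] t) (𝓝 (g t)) :=
      (hd t htI).continuousAt.tendsto.mono_left nhdsWithin_le_nhds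
    exact ge_of_tendsto hc (hev.mono fun s hs => hs.le)
  have h0 : g t = 0 := le_antisymm ht.2 hge
  have hlt := (slope_pos_right (hd t htI) (h t htI hpos h0)).2
  obtain ⟨s, hs1, hs2⟩ := (hev.and hlt).exists
  rw [h0] at hs2
  linarith

open Filter Topology Set in
/-- Simple version: all zeros are up-crossings. -/
lemma up_cross_right {g g' : ℝ → ℝ} {x y : ℝ} (hd : ∀ z ∈ Icc x y, HasDerivAt g (g' z) z)
    (h : ∀ z ∈ Icc x y, g z = 0 → 0 < g' z) (hx : 0 ≤ g x) :
    ∀ z ∈ Ioc x y, 0 < g z :=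
  first_cross hd (fun z hz _ => h z hz) hx

open Filter Topology Set in
lemma up_cross_left {g g' : ℝ → ℝ} {x y : ℝ} (hd : ∀ z ∈ Icc x y, HasDerivAt g (g' z) z)
    (h : ∀ z ∈ Icc x y, g z = 0 → 0 < g' z) (hy : g y ≤ 0) :
    ∀ z ∈ Ico x y, g z < 0 := by
  intro z hz
  by_contra hneg
  push Not at hneg
  have := up_cross_right (g := g) (g' := g') (x := z) (y := y)
    (fun s hs => hd s ⟨hz.1.trans hs.1, hs.2⟩) (fun s hs => h s ⟨hz.1.trans hs.1, hs.2⟩) hneg y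
    ⟨hz.2, le_rfl⟩
  linarith

open Filter Topology Set in
lemma ift_local {F : ℝ × ℝ → ℝ} {e₀ β₀ D : ℝ} (hF : AnalyticAt ℝ F (e₀, β₀))
    (h0 : F (e₀, β₀) = 0) (hD : HasDerivAt (fun β => F (e₀, β)) D β₀) (hD0 : D ≠ 0) :
    ∃ g : ℝ → ℝ, AnalyticAt ℝ g e₀ ∧ g e₀ = β₀ ∧ ∀ᶠ e in 𝓝 e₀, F (e, g e) = 0 := by
  have cdf : ContDiffAt ℝ ⊤ F (e₀, β₀) := hF.contDiffAt
  have hfd : HasFDerivAt F (fderiv ℝ F (e₀, β₀)) (e₀, β₀) := hF.differentiableAt.hasFDerivAt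
  have h1 : HasDerivAt (fun β => F (e₀, β)) (fderiv ℝ F (e₀, β₀) (0, 1)) β₀ := by
    have h2 : HasDerivAt (fun β : ℝ => (e₀, β)) ((0 : ℝ), (1 : ℝ)) β₀ :=
      (hasDerivAt_const β₀ e₀).prodMk (hasDerivAt_id β₀)
    exact HasFDerivAt.comp_hasDerivAt β₀ hfd h2
  have h3 : fderiv ℝ F (e₀, β₀) (0, 1) = D := h1.unique hD
  have hinv : (fderiv ℝ F (e₀, β₀) ∘L .inr ℝ ℝ ℝ).IsInvertible := by
    refine ⟨ContinuousLinearEquiv.unitsEquivAut ℝ (Units.mk0 D hD0), ?_⟩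
    ext
    simp [h3]
  refine ⟨cdf.implicitFunction (by simp) hinv, ?_, ?_, ?_⟩
  · exact (cdf.contDiffAt_implicitFunction (by simp) hinv).analyticAt
  · exact cdf.implicitFunction_apply_self (by simp) hinv
  · have := cdf.eventually_apply_implicitFunction (by simp) hinv
    rw [h0] at this
    exact this

open Filter Topology Set in
lemma glue {F : ℝ × ℝ → ℝ} {P : ℝ × ℝ → Prop} {D : ℝ → ℝ → ℝ}
    (hF : ∀ e ∈ Ico (0:ℝ) 1, ∀ β ∈ Ioo (0:ℝ) 1, AnalyticAt ℝ F (e, β))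
    (hex : ∀ e ∈ Ico (0:ℝ) 1, ∃ β ∈ Ioo (0:ℝ) 1, P (e, β) ∧ F (e, β) = 0)
    (huniq : ∀ e ∈ Ico (0:ℝ) 1, ∀ β ∈ Ioo (0:ℝ) 1, ∀ β' ∈ Ioo (0:ℝ) 1,
      P (e, β) → F (e, β) = 0 → P (e, β') → F (e, β') = 0 → β = β')
    (hP : ∀ e ∈ Ico (0:ℝ) 1, ∀ β ∈ Ioo (0:ℝ) 1, P (e, β) → ∀ᶠ z in 𝓝 (e, β), P z)
    (hD : ∀ e ∈ Ico (0:ℝ) 1, ∀ β ∈ Ioo (0:ℝ) 1, P (e, β) → F (e, β) = 0 →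
      HasDerivAt (fun β => F (e, β)) (D e β) β ∧ D e β ≠ 0) :
    ∃ r : ℝ → ℝ, AnalyticOnNhd ℝ r (Ico 0 1) ∧
      ∀ e ∈ Ico (0:ℝ) 1, r e ∈ Ioo (0:ℝ) 1 ∧ P (e, r e) ∧ F (e, r e) = 0 := by
  choose! r hr1 hr2 hr3 using hex
  have key : ∀ e ∈ Ico (0:ℝ) 1, ∃ g : ℝ → ℝ, AnalyticAt ℝ g e ∧
      ∀ᶠ e' in 𝓝 e, e' ∈ Ico (0:ℝ) 1 → r e' = g e' := by
    intro e he
    obtain ⟨hd, hd0⟩ := hD e he (r e) (hr1 e he) (hr2 e he) (hr3 e he)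
    obtain ⟨g, hg1, hg2, hg3⟩ := ift_local (hF e he _ (hr1 e he)) (hr3 e he) hd hd0
    refine ⟨g, hg1, ?_⟩
    have hc : Tendsto (fun e' => (e', g e')) (𝓝 e) (𝓝 (e, r e)) := by
      rw [← hg2]
      exact (continuousAt_id.prodMk hg1.continuousAt)
    have hc2 : Tendsto g (𝓝 e) (𝓝 (r e)) := by rw [← hg2]; exact hg1.continuousAt
    filter_upwards [hg3, hc.eventually (hP e he _ (hr1 e he) (hr2 e he)),
      hc2.eventually (Ioo_mem_nhds (hr1 e he).1 (hr1 e he).2)] with e' h1 h2 h3 he'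
    exact huniq e' he' _ (hr1 e' he') _ h3 (hr2 e' he') (hr3 e' he') h2 h1
  have h0 : (0:ℝ) ∈ Ico (0:ℝ) 1 := by simp
  obtain ⟨g0, hg0, hg0'⟩ := key 0 h0
  refine ⟨fun e => if 0 ≤ e then r e else g0 e, ?_, ?_⟩
  · intro e he
    rcases he.1.lt_or_eq with hpos | hz
    · obtain ⟨g, hg, hg'⟩ := key e he
      refine hg.congr ?_
      filter_upwards [hg', Ioo_mem_nhds hpos he.2] with e' h1 h2
      rw [if_pos h2.1.le, h1 ⟨h2.1.le, h2.2⟩]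
    · subst hz
      refine hg0.congr ?_
      filter_upwards [hg0', Iio_mem_nhds (zero_lt_one)] with e' h1 h2
      split_ifs with h
      · rw [h1 ⟨h, h2⟩]
      · rfl
  · intro e he
    simp only [if_pos he.1]
    exact ⟨hr1 e he, hr2 e he, hr3 e he⟩

/-- Scalar data of the half-period map, as functions of `β` for fixed `e`. -/
structure ScalarData (a b c d U V W : ℝ → ℝ) : Prop where
  ha : ∀ β ∈ Set.Icc (0:ℝ) 1, HasDerivAt a (d β * U β - a β * W β) β
  hb : ∀ β ∈ Set.Icc (0:ℝ) 1, HasDerivAt b (b β * W β - c β * V β) β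
  hc : ∀ β ∈ Set.Icc (0:ℝ) 1, HasDerivAt c (b β * U β - c β * W β) β
  hU : ∀ β ∈ Set.Icc (0:ℝ) 1, 0 < U β
  hV : ∀ β ∈ Set.Icc (0:ℝ) 1, 0 < V β
  hdet : ∀ β ∈ Set.Icc (0:ℝ) 1, a β * b β - c β * d β = 1
  a0 : a 0 = -1
  b0 : b 0 = -1
  c0 : c 0 = 0
  c1 : c 1 = 0
  b1 : 0 < b 1
  hd : ∀ β ∈ Set.Ioc (0:ℝ) 1, 0 < d β

namespace ScalarData
open Set

variable {a b c d U V W : ℝ → ℝ}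

lemma a1 (h : ScalarData a b c d U V W) : 0 < a 1 := by
  have := h.hdet 1 (by simp)
  rw [h.c1] at this
  have hb := h.b1
  by_contra hn
  push Not at hn
  nlinarith

lemma prod1 (h : ScalarData a b c d U V W) : a 1 * b 1 = 1 := by
  have := h.hdet 1 (by simp)
  rw [h.c1] at this
  linarith

lemma prod0 (h : ScalarData a b c d U V W) : a 0 * b 0 = 1 := by
  rw [h.a0, h.b0]; norm_num

/-- A function with up-crossing zeros, negative at 0 and positive at 1. -/
lemma split {g g' : ℝ → ℝ} (hd : ∀ z ∈ Icc (0:ℝ) 1, HasDerivAt g (g' z) z)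
    (hz : ∀ z ∈ Ioo (0:ℝ) 1, g z = 0 → 0 < g' z) (h0 : g 0 < 0) (h1 : 0 < g 1) :
    ∃ x ∈ Ioo (0:ℝ) 1, g x = 0 ∧ (∀ z ∈ Ico 0 x, g z < 0) ∧ (∀ z ∈ Ioc x 1, 0 < g z) := by
  have hc : ContinuousOn g (Icc 0 1) := fun z hz => (hd z hz).continuousAt.continuousWithinAt
  obtain ⟨x, hx, hgx⟩ := intermediate_value_Ioo (zero_le_one) hc ⟨h0, h1⟩
  have hz' : ∀ z ∈ Icc (0:ℝ) 1, g z = 0 → 0 < g' z := by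
    intro z hzz hgz
    refine hz z ⟨lt_of_le_of_ne hzz.1 ?_, lt_of_le_of_ne hzz.2 ?_⟩ hgz
    · rintro rfl; linarith
    · rintro rfl; linarith
  refine ⟨x, hx, hgx, ?_, ?_⟩
  · exact up_cross_left (fun z hz => hd z ⟨hz.1, hz.2.trans hx.2.le⟩)
      (fun z hz => hz' z ⟨hz.1, hz.2.trans hx.2.le⟩) hgx.le
  · exact up_cross_right (fun z hz => hd z ⟨hx.1.le.trans hz.1, hz.2⟩)
      (fun z hz => hz' z ⟨hx.1.le.trans hz.1, hz.2⟩) hgx.ge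

lemma a_deriv_pos (h : ScalarData a b c d U V W) {z : ℝ} (hz : z ∈ Ioo (0:ℝ) 1) (h0 : a z = 0) :
    0 < d z * U z - a z * W z := by
  rw [h0]
  have := mul_pos (h.hd z ⟨hz.1, hz.2.le⟩) (h.hU z ⟨hz.1.le, hz.2.le⟩)
  linarith

lemma a_split (h : ScalarData a b c d U V W) :
    ∃ x ∈ Ioo (0:ℝ) 1, a x = 0 ∧ (∀ z ∈ Ico 0 x, a z < 0) ∧ (∀ z ∈ Ioc x 1, 0 < a z) :=
  split h.ha (fun _ hz h0 => h.a_deriv_pos hz h0) (by rw [h.a0]; norm_num) h.a1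

lemma c_neg (h : ScalarData a b c d U V W) : ∀ z ∈ Ioo (0:ℝ) 1, c z < 0 := by
  obtain ⟨x, hx, hax, hl, hr⟩ := h.a_split
  have hcx : c x < 0 := by
    have h1 := h.hdet x ⟨hx.1.le, hx.2.le⟩
    have h2 := h.hd x ⟨hx.1, hx.2.le⟩
    rw [hax] at h1
    by_contra hn
    push Not at hn
    nlinarith
  intro z hz
  rcases lt_trichotomy z x with hzx | hzx | hzx
  · have := up_cross_right (g := fun s => -c s) (g' := fun s => -(b s * U s - c s * W s))
      (x := 0) (y := z) (fun s hs => (h.hc s ⟨hs.1, hs.2.trans hz.2.le⟩).neg) ?_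
      (by simp [h.c0]) z ⟨hz.1, le_rfl⟩
    · simpa using this
    · intro s hs h0
      have hs' : s ∈ Icc (0:ℝ) 1 := ⟨hs.1, hs.2.trans hz.2.le⟩
      have h0 : c s = 0 := by simpa using h0
      have h1 := h.hdet s hs'
      have h2 := hl s ⟨hs.1, hs.2.trans_lt hzx⟩
      have hb : b s < 0 := by
        rw [h0] at h1
        by_contra hn
        push Not at hn
        nlinarith
      have := mul_neg_of_neg_of_pos hb (h.hU s hs')
      simp only [h0]
      linarith
  · rwa [hzx]
  · refine up_cross_left (g := c) (x := z) (y := 1)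
      (fun s hs => (h.hc s ⟨hz.1.le.trans hs.1, hs.2⟩)) ?_ h.c1.le z ⟨le_rfl, hz.2⟩
    intro s hs h0
    have hs' : s ∈ Icc (0:ℝ) 1 := ⟨hz.1.le.trans hs.1, hs.2⟩
    have h1 := h.hdet s hs'
    have h2 := hr s ⟨hzx.trans_le hs.1, hs.2⟩
    have hb : 0 < b s := by
      rw [h0] at h1
      by_contra hn
      push Not at hn
      nlinarith
    have := mul_pos hb (h.hU s hs')
    rw [h0]
    linarith

lemma b_deriv_pos (h : ScalarData a b c d U V W) {z : ℝ} (hz : z ∈ Ioo (0:ℝ) 1) (h0 : b z = 0) :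
    0 < b z * W z - c z * V z := by
  rw [h0]
  have := mul_neg_of_neg_of_pos (h.c_neg z hz) (h.hV z ⟨hz.1.le, hz.2.le⟩)
  linarith

lemma b_split (h : ScalarData a b c d U V W) :
    ∃ x ∈ Ioo (0:ℝ) 1, b x = 0 ∧ (∀ z ∈ Ico 0 x, b z < 0) ∧ (∀ z ∈ Ioc x 1, 0 < b z) :=
  split h.hb (fun _ hz h0 => h.b_deriv_pos hz h0) (by rw [h.b0]; norm_num) h.b1

lemma split_unique {g : ℝ → ℝ}
    (h : ∃ x ∈ Ioo (0:ℝ) 1, g x = 0 ∧ (∀ z ∈ Ico 0 x, g z < 0) ∧ (∀ z ∈ Ioc x 1, 0 < g z))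
    {y z : ℝ} (hy : y ∈ Icc (0:ℝ) 1) (hz : z ∈ Icc (0:ℝ) 1) (hgy : g y = 0) (hgz : g z = 0) :
    y = z := by
  obtain ⟨x, hx, hx0, hl, hr⟩ := h
  have key : ∀ y ∈ Icc (0:ℝ) 1, g y = 0 → y = x := by
    intro y hy hgy
    rcases lt_trichotomy y x with h | h | h
    · have := hl y ⟨hy.1, h⟩; linarith
    · exact h
    · have := hr y ⟨h, hy.2⟩; linarith
  rw [key y hy hgy, key z hz hgz]

/-- Monotone propagation of sign conditions. -/
lemma split_neg {g : ℝ → ℝ}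
    (h : ∃ x ∈ Ioo (0:ℝ) 1, g x = 0 ∧ (∀ z ∈ Ico 0 x, g z < 0) ∧ (∀ z ∈ Ioc x 1, 0 < g z))
    {y z : ℝ} (hy : 0 ≤ y) (hz : z ≤ 1) (hyz : y ≤ z) (hgz : g z < 0) : g y < 0 := by
  obtain ⟨x, hx, hx0, hl, hr⟩ := h
  have : z < x := by
    by_contra hn
    push Not at hn
    rcases hn.lt_or_eq with h | h
    · have := hr z ⟨h, hz⟩; linarith
    · rw [h] at hx0; linarith
  exact hl y ⟨hy, hyz.trans_lt this⟩

lemma split_pos {g : ℝ → ℝ}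
    (h : ∃ x ∈ Ioo (0:ℝ) 1, g x = 0 ∧ (∀ z ∈ Ico 0 x, g z < 0) ∧ (∀ z ∈ Ioc x 1, 0 < g z))
    {y z : ℝ} (hy : 0 ≤ y) (hz : z ≤ 1) (hyz : y ≤ z) (hgy : 0 < g y) : 0 < g z := by
  obtain ⟨x, hx, hx0, hl, hr⟩ := h
  have : x < y := by
    by_contra hn
    push Not at hn
    rcases hn.lt_or_eq with h | h
    · have := hl y ⟨hy, h⟩; linarith
    · rw [h] at hgy; linarith
  exact hr z ⟨this.trans_le hyz, hz⟩

/-- Derivative of the product `a * b` -/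
lemma prod_deriv (h : ScalarData a b c d U V W) {z : ℝ} (hz : z ∈ Icc (0:ℝ) 1) (κ : ℝ) :
    HasDerivAt (fun s => a s * b s - κ) (b z * d z * U z - a z * c z * V z) z := by
  have := ((h.ha z hz).mul (h.hb z hz)).sub_const κ
  exact this.congr_deriv (by ring)

lemma prod_deriv_neg (h : ScalarData a b c d U V W) {z : ℝ} (hz : z ∈ Ioo (0:ℝ) 1)
    (ha : a z < 0) (hb : b z < 0) : b z * d z * U z - a z * c z * V z < 0 := by
  have hz' : z ∈ Icc (0:ℝ) 1 := ⟨hz.1.le, hz.2.le⟩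
  have h1 := mul_pos (mul_pos (neg_pos.2 hb) (h.hd z ⟨hz.1, hz.2.le⟩)) (h.hU z hz')
  have h2 := mul_pos (mul_pos_of_neg_of_neg ha (h.c_neg z hz)) (h.hV z hz')
  linarith

lemma prod_deriv_pos (h : ScalarData a b c d U V W) {z : ℝ} (hz : z ∈ Ioo (0:ℝ) 1)
    (ha : 0 < a z) (hb : 0 < b z) : 0 < b z * d z * U z - a z * c z * V z := by
  have hz' : z ∈ Icc (0:ℝ) 1 := ⟨hz.1.le, hz.2.le⟩
  have h1 := mul_pos (mul_pos hb (h.hd z ⟨hz.1, hz.2.le⟩)) (h.hU z hz')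
  have h2 := mul_pos (mul_pos ha (neg_pos.2 (h.c_neg z hz))) (h.hV z hz')
  linarith

lemma unique_neg (h : ScalarData a b c d U V W) {κ x y : ℝ} (hx : x ∈ Ioo (0:ℝ) 1)
    (hy : y ∈ Ioo (0:ℝ) 1) (hay : a y < 0) (hby : b y < 0)
    (h0x : a x * b x - κ = 0) (h0y : a y * b y - κ = 0) : ¬ x < y := by
  intro hxy
  have := up_cross_right (g := fun s => -(a s * b s - κ))
    (g' := fun z => -(b z * d z * U z - a z * c z * V z)) (x := x) (y := y)
    (fun s hs => (h.prod_deriv ⟨hx.1.le.trans hs.1, hs.2.trans hy.2.le⟩ κ).neg) ?_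
    (by rw [h0x]; simp) y ⟨hxy, le_rfl⟩
  · rw [h0y] at this; simp at this
  · intro s hs _
    have h1 := split_neg h.a_split (hx.1.le.trans hs.1) hy.2.le hs.2 hay
    have h2 := split_neg h.b_split (hx.1.le.trans hs.1) hy.2.le hs.2 hby
    have := h.prod_deriv_neg ⟨hx.1.trans_le hs.1, hs.2.trans_lt hy.2⟩ h1 h2
    linarith

lemma unique_pos (h : ScalarData a b c d U V W) {κ x y : ℝ} (hx : x ∈ Ioo (0:ℝ) 1)
    (hy : y ∈ Ioo (0:ℝ) 1) (hax : 0 < a x) (hbx : 0 < b x)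
    (h0x : a x * b x - κ = 0) (h0y : a y * b y - κ = 0) : ¬ x < y := by
  intro hxy
  have := up_cross_right (g := fun s => (a s * b s - κ))
    (g' := fun z => (b z * d z * U z - a z * c z * V z)) (x := x) (y := y)
    (fun s hs => (h.prod_deriv ⟨hx.1.le.trans hs.1, hs.2.trans hy.2.le⟩ κ)) ?_
    (by rw [h0x]) y ⟨hxy, le_rfl⟩
  · rw [h0y] at this; simp at this
  · intro s hs _
    have h1 := split_pos h.a_split hx.1.le (hs.2.trans hy.2.le) hs.1 hax
    have h2 := split_pos h.b_split hx.1.le (hs.2.trans hy.2.le) hs.1 hbx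
    exact h.prod_deriv_pos ⟨hx.1.trans_le hs.1, hs.2.trans_lt hy.2⟩ h1 h2

lemma cont (h : ScalarData a b c d U V W) (κ : ℝ) :
    ContinuousOn (fun s => a s * b s - κ) (Icc 0 1) :=
  fun _ hz => (h.prod_deriv hz κ).continuousAt.continuousWithinAt

lemma exists_neg (h : ScalarData a b c d U V W) {κ : ℝ} (h0 : 0 < κ) (h1 : κ < 1) :
    ∃ x ∈ Ioo (0:ℝ) 1, (a x < 0 ∧ b x < 0) ∧ a x * b x - κ = 0 := by
  obtain ⟨x, hx, hx0, hxl, -⟩ := h.a_split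
  obtain ⟨y, hy, hy0, hyl, -⟩ := h.b_split
  have hm : 0 < min x y := lt_min hx.1 hy.1
  have hm1 : min x y ≤ 1 := (min_le_left _ _).trans hx.2.le
  have hp : a (min x y) * b (min x y) = 0 := by
    rcases min_choice x y with h | h <;> rw [h] <;> simp [hx0, hy0]
  obtain ⟨z, hz, hz0⟩ := intermediate_value_Ioo' hm.le
    ((h.cont κ).mono (Icc_subset_Icc le_rfl hm1)) (show (0:ℝ) ∈ Ioo _ _ by
      simp only [h.prod0, hp]; constructor <;> linarith)
  exact ⟨z, ⟨hz.1, hz.2.trans_le hm1⟩, ⟨hxl z ⟨hz.1.le, hz.2.trans_le (min_le_left _ _)⟩,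
    hyl z ⟨hz.1.le, hz.2.trans_le (min_le_right _ _)⟩⟩, hz0⟩

lemma exists_pos (h : ScalarData a b c d U V W) {κ : ℝ} (h0 : 0 < κ) (h1 : κ < 1) :
    ∃ x ∈ Ioo (0:ℝ) 1, (0 < a x ∧ 0 < b x) ∧ a x * b x - κ = 0 := by
  obtain ⟨x, hx, hx0, -, hxl⟩ := h.a_split
  obtain ⟨y, hy, hy0, -, hyl⟩ := h.b_split
  have hm : max x y < 1 := max_lt hx.2 hy.2
  have hm1 : 0 < max x y := hx.1.trans_le (le_max_left _ _)
  have hp : a (max x y) * b (max x y) = 0 := by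
    rcases max_choice x y with h | h <;> rw [h] <;> simp [hx0, hy0]
  obtain ⟨z, hz, hz0⟩ := intermediate_value_Ioo hm.le
    ((h.cont κ).mono (Icc_subset_Icc hm1.le le_rfl)) (show (0:ℝ) ∈ Ioo _ _ by
      simp only [h.prod1, hp]; constructor <;> linarith)
  exact ⟨z, ⟨hm1.trans hz.1, hz.2⟩, ⟨hxl z ⟨(le_max_left _ _).trans_lt hz.1, hz.2.le⟩,
    hyl z ⟨(le_max_right _ _).trans_lt hz.1, hz.2.le⟩⟩, hz0⟩

end ScalarData

open Filter Topology Set in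
/-- The abstract conclusion. -/
lemma abstract_main {a b c d U V W : ℝ × ℝ → ℝ}
    (han : ∀ e ∈ Ico (0:ℝ) 1, ∀ β ∈ Ioo (0:ℝ) 1, AnalyticAt ℝ a (e, β))
    (hbn : ∀ e ∈ Ico (0:ℝ) 1, ∀ β ∈ Ioo (0:ℝ) 1, AnalyticAt ℝ b (e, β))
    (h : ∀ e ∈ Ico (0:ℝ) 1, ScalarData (fun β => a (e, β)) (fun β => b (e, β))
      (fun β => c (e, β)) (fun β => d (e, β)) (fun β => U (e, β)) (fun β => V (e, β))
      (fun β => W (e, β))) {κ : ℝ} (hκ0 : 0 ≤ κ) (hκ1 : κ < 1) :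
    ∃ β₁ β₂ : ℝ → ℝ,
      AnalyticOnNhd ℝ β₁ (Set.Ico 0 1) ∧ AnalyticOnNhd ℝ β₂ (Set.Ico 0 1) ∧
      (∀ e ∈ Set.Ico (0 : ℝ) 1, β₁ e ∈ Set.Ioo (0 : ℝ) 1 ∧ β₂ e ∈ Set.Ioo (0 : ℝ) 1) ∧
      (∀ e ∈ Set.Ico (0 : ℝ) 1, ∀ β ∈ Set.Icc (0 : ℝ) 1,
        (a (e, β) * b (e, β) = κ ↔ β = β₁ e ∨ β = β₂ e)) := by
  rcases hκ0.lt_or_eq with hκ | hκ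
  · obtain ⟨r1, hr1, hr1'⟩ := glue (F := fun z => a z * b z - κ) (P := fun z => a z < 0 ∧ b z < 0)
      (D := fun e z => b (e, z) * d (e, z) * U (e, z) - a (e, z) * c (e, z) * V (e, z))
      (fun e he β hβ => ((han e he β hβ).mul (hbn e he β hβ)).sub analyticAt_const)
      (fun e he => (h e he).exists_neg hκ hκ1)
      (fun e he x hx y hy hPx hFx hPy hFy => le_antisymm
        (not_lt.1 ((h e he).unique_neg hy hx hPx.1 hPx.2 hFy hFx))
        (not_lt.1 ((h e he).unique_neg hx hy hPy.1 hPy.2 hFx hFy)))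
      (fun e he β hβ hP => ((han e he β hβ).continuousAt.eventually (gt_mem_nhds hP.1)).and
        ((hbn e he β hβ).continuousAt.eventually (gt_mem_nhds hP.2)))
      (fun e he β hβ hP _ => ⟨(h e he).prod_deriv ⟨hβ.1.le, hβ.2.le⟩ κ,
        ((h e he).prod_deriv_neg hβ hP.1 hP.2).ne⟩)
    obtain ⟨r2, hr2, hr2'⟩ := glue (F := fun z => a z * b z - κ) (P := fun z => 0 < a z ∧ 0 < b z)
      (D := fun e z => b (e, z) * d (e, z) * U (e, z) - a (e, z) * c (e, z) * V (e, z))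
      (fun e he β hβ => ((han e he β hβ).mul (hbn e he β hβ)).sub analyticAt_const)
      (fun e he => (h e he).exists_pos hκ hκ1)
      (fun e he x hx y hy hPx hFx hPy hFy => le_antisymm
        (not_lt.1 ((h e he).unique_pos hy hx hPy.1 hPy.2 hFy hFx))
        (not_lt.1 ((h e he).unique_pos hx hy hPx.1 hPx.2 hFx hFy)))
      (fun e he β hβ hP => ((han e he β hβ).continuousAt.eventually (lt_mem_nhds hP.1)).and
        ((hbn e he β hβ).continuousAt.eventually (lt_mem_nhds hP.2)))
      (fun e he β hβ hP _ => ⟨(h e he).prod_deriv ⟨hβ.1.le, hβ.2.le⟩ κ,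
        ((h e he).prod_deriv_pos hβ hP.1 hP.2).ne'⟩)
    refine ⟨r1, r2, hr1, hr2, fun e he => ⟨(hr1' e he).1, (hr2' e he).1⟩, ?_⟩
    intro e he β hβ
    constructor
    · intro hk
      have hβ0 : β ≠ 0 := by
        rintro rfl
        have : a (e, 0) * b (e, 0) = 1 := (h e he).prod0
        linarith
      have hβ1 : β ≠ 1 := by
        rintro rfl
        have : a (e, 1) * b (e, 1) = 1 := (h e he).prod1
        linarith
      have hβ' : β ∈ Ioo (0:ℝ) 1 := ⟨lt_of_le_of_ne hβ.1 hβ0.symm, lt_of_le_of_ne hβ.2 hβ1⟩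
      have hk0 : a (e, β) * b (e, β) - κ = 0 := by linarith
      have hpos : 0 < a (e, β) * b (e, β) := by linarith
      rcases mul_pos_iff.1 hpos with hP | hP
      · right
        obtain ⟨q1, q2, q3⟩ := hr2' e he
        exact le_antisymm
          (not_lt.1 ((h e he).unique_pos q1 hβ' q2.1 q2.2 q3 hk0))
          (not_lt.1 ((h e he).unique_pos hβ' q1 hP.1 hP.2 hk0 q3))
      · left
        obtain ⟨q1, q2, q3⟩ := hr1' e he
        exact le_antisymm
          (not_lt.1 ((h e he).unique_neg q1 hβ' hP.1 hP.2 q3 hk0))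
          (not_lt.1 ((h e he).unique_neg hβ' q1 q2.1 q2.2 hk0 q3))
    · rintro (rfl | rfl)
      · have := (hr1' e he).2.2
        linarith
      · have := (hr2' e he).2.2
        linarith
  · subst hκ
    obtain ⟨r1, hr1, hr1'⟩ := glue (F := a) (P := fun _ => True)
      (D := fun e z => d (e, z) * U (e, z) - a (e, z) * W (e, z)) han
      (fun e he => by
        obtain ⟨x, hx, hx0, -⟩ := (h e he).a_split
        exact ⟨x, hx, trivial, hx0⟩)
      (fun e he x hx y hy _ hFx _ hFy => ScalarData.split_unique (h e he).a_split
        ⟨hx.1.le, hx.2.le⟩ ⟨hy.1.le, hy.2.le⟩ hFx hFy)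
      (fun e he β hβ hP => Eventually.of_forall fun _ => trivial)
      (fun e he β hβ _ h0 => ⟨(h e he).ha β ⟨hβ.1.le, hβ.2.le⟩, ((h e he).a_deriv_pos hβ h0).ne'⟩)
    obtain ⟨r2, hr2, hr2'⟩ := glue (F := b) (P := fun _ => True)
      (D := fun e z => b (e, z) * W (e, z) - c (e, z) * V (e, z)) hbn
      (fun e he => by
        obtain ⟨x, hx, hx0, -⟩ := (h e he).b_split
        exact ⟨x, hx, trivial, hx0⟩)
      (fun e he x hx y hy _ hFx _ hFy => ScalarData.split_unique (h e he).b_split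
        ⟨hx.1.le, hx.2.le⟩ ⟨hy.1.le, hy.2.le⟩ hFx hFy)
      (fun e he β hβ hP => Eventually.of_forall fun _ => trivial)
      (fun e he β hβ _ h0 => ⟨(h e he).hb β ⟨hβ.1.le, hβ.2.le⟩, ((h e he).b_deriv_pos hβ h0).ne'⟩)
    refine ⟨r1, r2, hr1, hr2, fun e he => ⟨(hr1' e he).1, (hr2' e he).1⟩, ?_⟩
    intro e he β hβ
    rw [mul_eq_zero]
    constructor
    · rintro (h0 | h0)
      · left
        exact ScalarData.split_unique (h e he).a_split hβ
          ⟨(hr1' e he).1.1.le, (hr1' e he).1.2.le⟩ h0 (hr1' e he).2.2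
      · right
        exact ScalarData.split_unique (h e he).b_split hβ
          ⟨(hr2' e he).1.1.le, (hr2' e he).1.2.le⟩ h0 (hr2' e he).2.2
    · rintro (rfl | rfl)
      · exact Or.inl (hr1' e he).2.2
      · exact Or.inr (hr2' e he).2.2

/-- Continuous functions on `[0,π]`. -/
abbrev CI : Type := C(Set.Icc (0:ℝ) π, ℝ)

/-- Extension to the line. -/
def extI (f : CI) : ℝ → ℝ := Set.IccExtend pi_nonneg f

lemma ext_cont (f : CI) : Continuous (extI f) := f.continuous.Icc_extend'

lemma ext_of_mem (f : CI) {t : ℝ} (ht : t ∈ Set.Icc (0:ℝ) π) : extI f t = f ⟨t, ht⟩ :=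
  Set.IccExtend_of_mem _ _ ht

lemma ext_norm (f : CI) (t : ℝ) : ‖extI f t‖ ≤ ‖f‖ := by
  unfold extI Set.IccExtend
  exact f.norm_coe_le_norm _

/-- The Volterra operator as a linear map. -/
def voltLin : CI →ₗ[ℝ] CI where
  toFun f := ⟨fun t => ∫ s in (0:ℝ)..t, extI f s,
    (intervalIntegral.continuous_primitive
      (fun a b => (ext_cont f).intervalIntegrable a b) 0).comp continuous_subtype_val⟩
  map_add' f g := by
    ext t
    simp only [ContinuousMap.coe_mk, ContinuousMap.add_apply]
    rw [← intervalIntegral.integral_add ((ext_cont f).intervalIntegrable _ _)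
      ((ext_cont g).intervalIntegrable _ _)]
    rfl
  map_smul' r f := by
    ext t
    simp only [ContinuousMap.coe_mk, ContinuousMap.smul_apply, RingHom.id_apply, smul_eq_mul]
    rw [← intervalIntegral.integral_const_mul]
    rfl

lemma voltLin_bound (f : CI) (n : ℕ) (D : ℝ) (h : ∀ t, |f t| ≤ D * (t:ℝ) ^ n)
    (t : Set.Icc (0:ℝ) π) : |voltLin f t| ≤ D * (t:ℝ) ^ (n + 1) / (n + 1) := by
  have h1 : ‖∫ s in (0:ℝ)..t, extI f s‖ ≤ ∫ s in (0:ℝ)..t, D * s ^ n := by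
    refine intervalIntegral.norm_integral_le_of_norm_le t.2.1 ?_ ?_
    · refine Filter.Eventually.of_forall fun s hs => ?_
      have hs' : s ∈ Set.Icc (0:ℝ) π := ⟨hs.1.le, hs.2.trans t.2.2⟩
      rw [ext_of_mem f hs']
      exact h ⟨s, hs'⟩
    · exact (by fun_prop : Continuous fun s : ℝ => D * s ^ n).intervalIntegrable _ _
  have h2 : ∫ s in (0:ℝ)..t, D * s ^ n = D * (t:ℝ) ^ (n + 1) / (n + 1) := by
    rw [intervalIntegral.integral_const_mul, integral_pow]
    simp
    ring
  rw [h2] at h1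
  exact h1

/-- The Volterra operator. -/
def volt : CI →L[ℝ] CI := voltLin.mkContinuous π (by
  intro f
  rw [ContinuousMap.norm_le _ (by positivity)]
  intro t
  have := voltLin_bound f 0 ‖f‖ (fun t => by simpa using f.norm_coe_le_norm t) t
  simp only [zero_add, pow_one, Nat.cast_zero, div_one] at this
  refine (le_of_eq (Real.norm_eq_abs _)).trans (this.trans ?_)
  rw [mul_comm]
  exact mul_le_mul_of_nonneg_right t.2.2 (norm_nonneg _))

lemma volt_apply (f : CI) (t : Set.Icc (0:ℝ) π) : volt f t = ∫ s in (0:ℝ)..t, extI f s := rfl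

lemma volt_bound (f : CI) (n : ℕ) (D : ℝ) (h : ∀ t, |f t| ≤ D * (t:ℝ) ^ n)
    (t : Set.Icc (0:ℝ) π) : |volt f t| ≤ D * (t:ℝ) ^ (n + 1) / (n + 1) :=
  voltLin_bound f n D h t

/-- Multiplication. -/
def mulI : CI →L[ℝ] (CI →L[ℝ] CI) := ContinuousLinearMap.mul ℝ CI

/-- The second order Volterra operator with potential `m`. -/
def Kop (m : CI) : CI →L[ℝ] CI := (volt ∘L volt) ∘L (mulI m)

lemma Kop_apply (m f : CI) : Kop m f = volt (volt (m * f)) := rfl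

lemma Kop_pow_bound (m f : CI) (n : ℕ) (t : Set.Icc (0:ℝ) π) :
    |(Kop m ^ n) f t| ≤ ‖f‖ * ‖m‖ ^ n / (2 * n).factorial * (t:ℝ) ^ (2 * n) := by
  induction n generalizing t with
  | zero => simpa using f.norm_coe_le_norm t
  | succ n ih =>
    rw [pow_succ']
    have h0 : ∀ t : Set.Icc (0:ℝ) π, |(m * (Kop m ^ n) f) t| ≤
        (‖m‖ * (‖f‖ * ‖m‖ ^ n / (2 * n).factorial)) * (t:ℝ) ^ (2 * n) := by
      intro t
      rw [ContinuousMap.mul_apply, abs_mul, mul_assoc]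
      exact mul_le_mul (m.norm_coe_le_norm t) (ih t) (abs_nonneg _) (norm_nonneg _)
    have h1 := volt_bound _ _ _ h0
    have h2 := volt_bound (volt (m * (Kop m ^ n) f)) (2 * n + 1)
      ((‖m‖ * (‖f‖ * ‖m‖ ^ n / (2 * n).factorial)) / ((2 * n : ℕ) + 1)) (fun t => by
        refine (h1 t).trans (le_of_eq ?_)
        ring) t
    have h3 : (Kop m * Kop m ^ n) f = volt (volt (m * (Kop m ^ n) f)) := rfl
    rw [h3]
    refine h2.trans (le_of_eq ?_)
    have e1 : 2 * (n + 1) = 2 * n + 1 + 1 := by ring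
    rw [e1, Nat.factorial_succ, Nat.factorial_succ]
    push_cast
    field_simp
    ring

open Filter Topology in
lemma Kop_isUnit' (m : CI) : IsUnit (1 - Kop m) := by
  have hb : ∀ n, ‖Kop m ^ n‖ ≤ ((‖m‖ + 1) * π) ^ (2 * n) / (2 * n).factorial := by
    intro n
    refine ContinuousLinearMap.opNorm_le_bound _ (by positivity) fun f => ?_
    rw [ContinuousMap.norm_le _ (by positivity)]
    intro t
    refine (Kop_pow_bound m f n t).trans ?_
    have h1 : ‖m‖ ^ n ≤ (‖m‖ + 1) ^ (2 * n) := by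
      calc ‖m‖ ^ n ≤ (‖m‖ + 1) ^ n := by gcongr; linarith
        _ ≤ (‖m‖ + 1) ^ (2 * n) := by
          apply pow_le_pow_right₀
          · linarith [norm_nonneg m]
          · omega
    have h2 : (t:ℝ) ^ (2 * n) ≤ π ^ (2 * n) := pow_le_pow_left₀ t.2.1 t.2.2 _
    have ht := t.2.1
    calc ‖f‖ * ‖m‖ ^ n / (2 * n).factorial * (t:ℝ) ^ (2 * n)
        ≤ ‖f‖ * (‖m‖ + 1) ^ (2 * n) / (2 * n).factorial * π ^ (2 * n) := by gcongr
      _ = _ := by rw [mul_pow]; ring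
  have ht : Tendsto (fun n => ((‖m‖ + 1) * π) ^ (2 * n) / ((2 * n).factorial : ℝ)) atTop (𝓝 0) :=
    (FloorSemiring.tendsto_pow_div_factorial_atTop ((‖m‖ + 1) * π)).comp
      (tendsto_id.const_mul_atTop' (by norm_num : 0 < 2))
  obtain ⟨n, hn⟩ := (ht.eventually (gt_mem_nhds one_pos)).exists
  have hn' : ‖Kop m ^ n‖ < 1 := (hb n).trans_lt hn
  have hu : IsUnit (1 - Kop m ^ n) := isUnit_one_sub_of_norm_lt_one (R := CI →L[ℝ] CI) hn'
  have hc : Commute (1 - Kop m) (∑ i ∈ Finset.range n, Kop m ^ i) := by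
    unfold Commute SemiconjBy
    rw [mul_neg_geom_sum, geom_sum_mul_neg]
  rw [← mul_neg_geom_sum, hc.isUnit_mul_iff] at hu
  exact hu.1

lemma Kop_isUnit (m : CI) : IsUnit (1 + Kop m) := by
  have h : Kop m = -Kop (-m) := by
    refine ContinuousLinearMap.ext fun f => ?_
    have h1 : (-Kop (-m)) f = -(Kop (-m) f) := rfl
    rw [h1, Kop_apply, Kop_apply, neg_mul, map_neg, map_neg, neg_neg]
  rw [h, ← sub_eq_add_neg]
  exact Kop_isUnit' (-m)

/-- `cos` on `[0,π]`. -/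
def cosI : CI := ⟨fun t => Real.cos t, by fun_prop⟩
/-- `t` on `[0,π]`. -/
def idI : CI := ⟨fun t => (t:ℝ), by fun_prop⟩

/-- the weight -/
def wI (e : ℝ) : CI := Ring.inverse (1 + e • cosI)

lemma one_add_pos {e : ℝ} (he : |e| < 1) (t : ℝ) : 0 < 1 + e * Real.cos t := by
  have h1 : |e * Real.cos t| < 1 := by
    rw [abs_mul]
    calc |e| * |Real.cos t| ≤ |e| * 1 := by gcongr; exact Real.abs_cos_le_one t
      _ < 1 := by linarith
  linarith [(abs_lt.1 h1).1]

/-- the explicit inverse -/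
def wI' (e : ℝ) (he : |e| < 1) : CI := ⟨fun t => 1 / (1 + e * Real.cos t), by
  apply Continuous.div (by fun_prop) (by fun_prop)
  intro t
  exact (one_add_pos he t).ne'⟩

lemma w_mul (e : ℝ) (he : |e| < 1) : (1 + e • cosI) * wI' e he = 1 := by
  ext t
  have := (one_add_pos he t).ne'
  simp [cosI, wI', this]

lemma w_unit (e : ℝ) (he : |e| < 1) : IsUnit (1 + e • cosI) :=
  IsUnit.of_mul_eq_one _ (w_mul e he)

lemma wI_eq (e : ℝ) (he : |e| < 1) : wI e = wI' e he := by
  have h := Ring.inverse_mul_cancel _ (w_unit e he)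
  have h2 := w_mul e he
  unfold wI
  calc Ring.inverse (1 + e • cosI) = Ring.inverse (1 + e • cosI) * ((1 + e • cosI) * wI' e he) := by
        rw [h2, mul_one]
    _ = _ := by rw [← mul_assoc, h, one_mul]

lemma wI_apply (e : ℝ) (he : |e| < 1) (t : Set.Icc (0:ℝ) π) :
    wI e t = 1 / (1 + e * Real.cos t) := by rw [wI_eq e he]; rfl

lemma wI_analytic (e : ℝ) (he : |e| < 1) : AnalyticAt ℝ wI e := by
  have h1 : AnalyticAt ℝ (fun e : ℝ => (1 : CI) + e • cosI) e := by fun_prop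
  obtain ⟨u, hu⟩ := w_unit e he
  have h2 := analyticAt_inverse (𝕜 := ℝ) u
  rw [hu] at h2
  exact AnalyticAt.comp h2 h1

/-- the potential -/
def mI (z : ℝ × ℝ) : CI := 1 - z.2 • wI z.1

lemma mI_analytic (z : ℝ × ℝ) (he : |z.1| < 1) : AnalyticAt ℝ mI z := by
  have h1 : AnalyticAt ℝ (fun z : ℝ × ℝ => wI z.1) z :=
    AnalyticAt.comp (g := wI) (wI_analytic z.1 he) analyticAt_fst
  exact analyticAt_const.sub (analyticAt_snd.smul h1)

/-- solution operator -/
def sol (g : CI) (z : ℝ × ℝ) : CI := Ring.inverse (1 + Kop (mI z)) g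

lemma Kop_analytic (z : ℝ × ℝ) (he : |z.1| < 1) :
    AnalyticAt ℝ (fun z => (1 : CI →L[ℝ] CI) + Kop (mI z)) z := by
  have h1 : AnalyticAt ℝ (fun z => mulI (mI z)) z :=
    AnalyticAt.comp (g := fun m => mulI m) (f := mI)
      (ContinuousLinearMap.analyticAt (𝕜 := ℝ) (E := CI) (F := CI →L[ℝ] CI) mulI (mI z))
      (mI_analytic z he)
  have h2 : AnalyticAt ℝ (fun z => ContinuousLinearMap.compL ℝ CI CI CI (volt ∘L volt)
      (mulI (mI z))) z :=
    AnalyticAt.comp (g := fun m => ContinuousLinearMap.compL ℝ CI CI CI (volt ∘L volt) m)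
      (f := fun z => mulI (mI z))
      (ContinuousLinearMap.analyticAt (𝕜 := ℝ) (E := CI →L[ℝ] CI) (F := CI →L[ℝ] CI)
        (ContinuousLinearMap.compL ℝ CI CI CI (volt ∘L volt)) _) h1
  exact analyticAt_const.add h2

lemma sol_analytic (g : CI) (z : ℝ × ℝ) (he : |z.1| < 1) : AnalyticAt ℝ (sol g) z := by
  obtain ⟨u, hu⟩ := Kop_isUnit (mI z)
  have h2 := analyticAt_inverse (𝕜 := ℝ) (A := CI →L[ℝ] CI) u
  rw [hu] at h2
  have h3 : AnalyticAt ℝ (fun z => Ring.inverse (1 + Kop (mI z))) z :=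
    AnalyticAt.comp (g := Ring.inverse) (f := fun z => (1 : CI →L[ℝ] CI) + Kop (mI z))
      h2 (Kop_analytic z he)
  exact ((ContinuousLinearMap.apply ℝ CI g).analyticAt _).comp h3

lemma sol_unique (g f : CI) (z : ℝ × ℝ) (h : f + Kop (mI z) f = g) : f = sol g z := by
  have h1 : (1 + Kop (mI z)) f = g := by simpa using h
  have h2 := Ring.inverse_mul_cancel _ (Kop_isUnit (mI z))
  unfold sol
  rw [← h1, ← mul_apply_eq_comp, h2]
  rfl

/-- The derivative part of the solution. -/
def solp (p₀ : ℝ) (g : CI) (z : ℝ × ℝ) : CI := p₀ • 1 - volt (mI z * sol g z)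

lemma solp_analytic (p₀ : ℝ) (g : CI) (z : ℝ × ℝ) (he : |z.1| < 1) :
    AnalyticAt ℝ (solp p₀ g) z := by
  have := (mI_analytic z he).mul (sol_analytic g z he)
  exact analyticAt_const.sub ((volt.analyticAt _).comp this)

/-- The endpoint. -/
def piI : Set.Icc (0:ℝ) π := ⟨π, pi_nonneg, le_rfl⟩

lemma eval_analytic {f : ℝ × ℝ → CI} {z : ℝ × ℝ} (h : AnalyticAt ℝ f z) (t : Set.Icc (0:ℝ) π) :
    AnalyticAt ℝ (fun z => f z t) z :=
  AnalyticAt.comp (g := fun f : CI => f t)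
    (ContinuousLinearMap.analyticAt (E := CI) (F := ℝ) (ContinuousMap.evalCLM ℝ t) _) h

/-- `q'' = -(1 - β/(1+e cos t)) q` with `p = q'`. -/
def IsSol (e β : ℝ) (q p : ℝ → ℝ) : Prop :=
  ∀ t, HasDerivAt q (p t) t ∧ HasDerivAt p (-(1 - β / (1 + e * Real.cos t)) * q t) t

namespace IsSol
open Set

lemma contq {e β : ℝ} {q p : ℝ → ℝ} (h : IsSol e β q p) : Continuous q :=
  continuous_iff_continuousAt.2 fun t => (h t).1.continuousAt

lemma contp {e β : ℝ} {q p : ℝ → ℝ} (h : IsSol e β q p) : Continuous p :=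
  continuous_iff_continuousAt.2 fun t => (h t).2.continuousAt

/-- restriction to `[0,π]` -/
def res (q : ℝ → ℝ) (hq : Continuous q) : CI := ⟨fun t => q t, by fun_prop⟩

lemma w_cont {e : ℝ} (he : |e| < 1) : Continuous fun t => 1 / (1 + e * Real.cos t) := by
  apply Continuous.div (by fun_prop) (by fun_prop)
  intro t
  exact (one_add_pos he t).ne'

lemma rep_p {e β : ℝ} {q p : ℝ → ℝ} (h : IsSol e β q p) (he : |e| < 1) :
    volt (mI (e, β) * res q h.contq) = p 0 • 1 - res p h.contp := by
  ext t
  rw [volt_apply]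
  have hc : Continuous fun t => -(1 - β / (1 + e * Real.cos t)) * q t := by
    have h1 := w_cont he
    have h2 := h.contq
    have h3 : (fun t => -(1 - β / (1 + e * Real.cos t)) * q t) =
      fun t => -(1 - β * (1 / (1 + e * Real.cos t))) * q t := by
      ext t; rw [mul_one_div]
    rw [h3]
    fun_prop
  have h1 : ∫ s in (0:ℝ)..t, -(1 - β / (1 + e * Real.cos s)) * q s = p t - p 0 :=
    intervalIntegral.integral_eq_sub_of_hasDerivAt (fun s _ => (h s).2) (hc.intervalIntegrable _ _)
  have h2 : ∫ s in (0:ℝ)..t, extI (mI (e, β) * res q h.contq) s =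
      ∫ s in (0:ℝ)..t, -(-(1 - β / (1 + e * Real.cos s)) * q s) := by
    refine intervalIntegral.integral_congr fun s hs => ?_
    rw [uIcc_of_le t.2.1] at hs
    have hs' : s ∈ Icc (0:ℝ) π := ⟨hs.1, hs.2.trans t.2.2⟩
    rw [ext_of_mem _ hs']
    simp only [mI, res, ContinuousMap.mul_apply, ContinuousMap.sub_apply, ContinuousMap.smul_apply,
      ContinuousMap.one_apply, ContinuousMap.coe_mk, wI_apply e he, smul_eq_mul]
    ring
  rw [h2, intervalIntegral.integral_neg, h1]
  simp [res]

lemma rep_q {e β : ℝ} {q p : ℝ → ℝ} (h : IsSol e β q p) :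
    volt (res p h.contp) = res q h.contq - q 0 • 1 := by
  ext t
  rw [volt_apply]
  have h1 : ∫ s in (0:ℝ)..t, p s = q t - q 0 :=
    intervalIntegral.integral_eq_sub_of_hasDerivAt (fun s _ => (h s).1)
      (h.contp.intervalIntegrable _ _)
  have h2 : ∫ s in (0:ℝ)..t, extI (res p h.contp) s = ∫ s in (0:ℝ)..t, p s := by
    refine intervalIntegral.integral_congr fun s hs => ?_
    rw [uIcc_of_le t.2.1] at hs
    have hs' : s ∈ Icc (0:ℝ) π := ⟨hs.1, hs.2.trans t.2.2⟩
    rw [ext_of_mem _ hs']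
    rfl
  rw [h2, h1]
  simp [res]

lemma volt_one : volt 1 = idI := by
  ext t
  rw [volt_apply]
  have h2 : ∫ s in (0:ℝ)..t, extI 1 s = ∫ s in (0:ℝ)..t, (1:ℝ) := by
    refine intervalIntegral.integral_congr fun s hs => ?_
    rw [uIcc_of_le t.2.1] at hs
    have hs' : s ∈ Icc (0:ℝ) π := ⟨hs.1, hs.2.trans t.2.2⟩
    rw [ext_of_mem _ hs']
    rfl
  rw [h2]
  simp [idI]

/-- Wronskian derivative. -/
lemma wr {e β₁ β₂ : ℝ} {q₁ p₁ q₂ p₂ : ℝ → ℝ} (h₁ : IsSol e β₁ q₁ p₁) (h₂ : IsSol e β₂ q₂ p₂)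
    (t : ℝ) : HasDerivAt (fun t => p₁ t * q₂ t - q₁ t * p₂ t)
      ((β₁ - β₂) * (1 / (1 + e * Real.cos t) * q₁ t * q₂ t)) t := by
  have := ((h₁ t).2.mul (h₂ t).1).sub ((h₁ t).1.mul (h₂ t).2)
  exact this.congr_deriv (by ring)

lemma wr_const {e β : ℝ} {q₁ p₁ q₂ p₂ : ℝ → ℝ} (h₁ : IsSol e β q₁ p₁) (h₂ : IsSol e β q₂ p₂)
    (s t : ℝ) : p₁ s * q₂ s - q₁ s * p₂ s = p₁ t * q₂ t - q₁ t * p₂ t := by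
  have := is_const_of_deriv_eq_zero (f := fun t => p₁ t * q₂ t - q₁ t * p₂ t)
    (fun t => (wr h₁ h₂ t).differentiableAt) (fun t => by rw [(wr h₁ h₂ t).deriv]; ring) s t
  exact this

lemma wr_int {e β₁ β₂ : ℝ} (he : |e| < 1) {q₁ p₁ q₂ p₂ : ℝ → ℝ} (h₁ : IsSol e β₁ q₁ p₁)
    (h₂ : IsSol e β₂ q₂ p₂) :
    p₁ π * q₂ π - q₁ π * p₂ π = p₁ 0 * q₂ 0 - q₁ 0 * p₂ 0 +
      (β₁ - β₂) * ∫ t in (0:ℝ)..π, 1 / (1 + e * Real.cos t) * q₁ t * q₂ t := by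
  have hc : Continuous fun t => 1 / (1 + e * Real.cos t) * q₁ t * q₂ t :=
    ((w_cont he).mul h₁.contq).mul h₂.contq
  have := intervalIntegral.integral_eq_sub_of_hasDerivAt (a := 0) (b := π)
    (fun s _ => wr h₁ h₂ s) ((hc.const_smul (β₁ - β₂)).intervalIntegrable _ _)
  rw [intervalIntegral.integral_const_mul] at this
  linarith

lemma volt_int {e : ℝ} (he : |e| < 1) {q₁ q₂ : ℝ → ℝ} (h₁ : Continuous q₁) (h₂ : Continuous q₂) :
    volt (wI e * res q₁ h₁ * res q₂ h₂) piI =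
      ∫ t in (0:ℝ)..π, 1 / (1 + e * Real.cos t) * q₁ t * q₂ t := by
  rw [volt_apply]
  refine intervalIntegral.integral_congr fun s hs => ?_
  have hp : ((piI : Icc (0:ℝ) π) : ℝ) = π := rfl
  rw [hp, uIcc_of_le pi_nonneg] at hs
  rw [ext_of_mem _ hs]
  simp only [res, ContinuousMap.mul_apply, ContinuousMap.coe_mk, wI_apply e he]

lemma cos_sol (e : ℝ) : IsSol e 0 Real.cos (fun t => -Real.sin t) := fun t =>
  ⟨Real.hasDerivAt_cos t, (Real.hasDerivAt_sin t).neg.congr_deriv (by simp)⟩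

lemma sin_sol (e : ℝ) : IsSol e 0 Real.sin Real.cos := fun t =>
  ⟨Real.hasDerivAt_sin t, by simpa using Real.hasDerivAt_cos t⟩

lemma phi_sol {e : ℝ} (he : |e| < 1) :
    IsSol e 1 (fun t => 1 + e * Real.cos t) (fun t => -(e * Real.sin t)) := fun t => by
  have hpos := one_add_pos he t
  constructor
  · exact (((Real.hasDerivAt_cos t).const_mul e).const_add 1).congr_deriv (by ring)
  · exact (((Real.hasDerivAt_sin t).const_mul e).neg).congr_deriv (by field_simp; ring)

lemma reflect {e β : ℝ} {q p : ℝ → ℝ} (h : IsSol e β q p) :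
    IsSol e β (fun t => q (2 * π - t)) (fun t => -p (2 * π - t)) := fun t => by
  have hl : HasDerivAt (fun t : ℝ => 2 * π - t) (-1) t := by
    simpa using (hasDerivAt_id t).const_sub (2 * π)
  have h1 := (h (2 * π - t)).1.comp t hl
  have h2 := ((h (2 * π - t)).2.comp t hl).neg
  rw [Real.cos_two_pi_sub] at h2
  exact ⟨h1.congr_deriv (by ring), h2.congr_deriv (by ring)⟩

/-- Sturm comparison with `sin`. -/
lemma sturm {e β : ℝ} (he : |e| < 1) (hβ : 0 < β) {q p : ℝ → ℝ} (h : IsSol e β q p)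
    (hq : q 0 = 0) (hp : p 0 = 1) : 0 < q π := by
  refine first_cross (g := q) (g' := p) (x := 0) (y := π) (fun t _ => (h t).1) ?_ hq.ge π
    ⟨pi_pos, le_rfl⟩
  intro z hz hpos hqz
  rcases hz.1.lt_or_eq with hz0 | hz0
  · have hmono : StrictMonoOn (fun t => p t * Real.sin t - q t * Real.cos t) (Icc 0 z) := by
      apply strictMonoOn_of_deriv_pos (convex_Icc 0 z)
      · exact fun t _ => (wr h (sin_sol e) t).continuousAt.continuousWithinAt
      · intro t ht
        rw [interior_Icc] at ht
        rw [(wr h (sin_sol e) t).deriv]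
        have h1 := one_add_pos he t
        have h2 := hpos t ht
        have h3 := Real.sin_pos_of_pos_of_lt_pi ht.1 (ht.2.trans_le hz.2)
        rw [sub_zero]
        positivity
    have h1 := hmono ⟨le_rfl, hz0.le⟩ ⟨hz0.le, le_rfl⟩ hz0
    simp only [hq, hqz, Real.sin_zero] at h1
    have h3 := Real.sin_nonneg_of_nonneg_of_le_pi hz.1 hz.2
    have h4 : 0 < p z * Real.sin z := by linarith
    exact pos_of_mul_pos_left h4 h3
  · rw [← hz0, hp]; norm_num

/-- positivity of the weighted square integral -/
lemma int_pos {e β : ℝ} (he : |e| < 1) {q p : ℝ → ℝ} (h : IsSol e β q p)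
    (hne : ∃ t ∈ Icc (0:ℝ) π, q t ≠ 0) :
    0 < ∫ t in (0:ℝ)..π, 1 / (1 + e * Real.cos t) * q t * q t := by
  have hc : Continuous fun t => 1 / (1 + e * Real.cos t) * q t * q t :=
    ((w_cont he).mul h.contq).mul h.contq
  obtain ⟨s, hs, hqs⟩ := hne
  refine intervalIntegral.integral_pos pi_pos hc.continuousOn (fun t _ => ?_) ⟨s, hs, ?_⟩
  · have := one_add_pos he t
    rw [mul_assoc]
    exact mul_nonneg (by positivity) (mul_self_nonneg _)
  · have := one_add_pos he s
    rw [mul_assoc]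
    exact mul_pos (by positivity) (mul_self_pos.2 hqs)

lemma ne_of_deriv {e β : ℝ} {q p : ℝ → ℝ} (h : IsSol e β q p) (hq : q 0 = 0) (hp : p 0 = 1) :
    ∃ t ∈ Icc (0:ℝ) π, q t ≠ 0 := by
  have h1 := (slope_pos_right (h 0).1 (by rw [hp]; norm_num)).1
  obtain ⟨s, hs, hs'⟩ := (h1.and (Ioo_mem_nhdsGT pi_pos)).exists
  exact ⟨s, ⟨hs'.1.le, hs'.2.le⟩, by rw [hq] at hs; exact hs.ne'⟩

end IsSol

/-- solution as analytic function of parameters -/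
def Qf (q₀ p₀ : ℝ) (z : ℝ × ℝ) : CI := sol (q₀ • 1 + p₀ • idI) z
/-- derivative of the solution -/
def Pf (q₀ p₀ : ℝ) (z : ℝ × ℝ) : CI := solp p₀ (q₀ • 1 + p₀ • idI) z

lemma Qf_eq {e β : ℝ} {q p : ℝ → ℝ} (h : IsSol e β q p) (he : |e| < 1) :
    Qf (q 0) (p 0) (e, β) = IsSol.res q h.contq := by
  symm
  apply sol_unique
  rw [Kop_apply, h.rep_p he, map_sub, map_smul, IsSol.volt_one, h.rep_q]
  abel

lemma Pf_eq {e β : ℝ} {q p : ℝ → ℝ} (h : IsSol e β q p) (he : |e| < 1) :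
    Pf (q 0) (p 0) (e, β) = IsSol.res p h.contp := by
  have h1 := Qf_eq h he
  unfold Qf at h1
  unfold Pf solp
  rw [h1, h.rep_p he]
  abel

/-- Existence of solutions. -/
def HasSols : Prop := ∀ e ∈ Set.Ico (0:ℝ) 1, ∀ β ∈ Set.Icc (0:ℝ) 1, ∀ q₀ p₀ : ℝ,
  ∃ q p, IsSol e β q p ∧ q 0 = q₀ ∧ p 0 = p₀

lemma abs_lt_of_mem {e : ℝ} (he : e ∈ Set.Ico (0:ℝ) 1) : |e| < 1 := by
  rw [abs_of_nonneg he.1]; exact he.2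

lemma slice_diff {f : ℝ × ℝ → ℝ} {e β : ℝ} (h : AnalyticAt ℝ f (e, β)) :
    DifferentiableAt ℝ (fun b => f (e, b)) β := by
  have h2 : DifferentiableAt ℝ (fun β : ℝ => (e, β)) β := by fun_prop
  exact DifferentiableAt.comp (g := f) β h.differentiableAt h2

lemma Qf_an (q₀ p₀ : ℝ) {e β : ℝ} (he : |e| < 1) : AnalyticAt ℝ (Qf q₀ p₀) (e, β) :=
  sol_analytic _ _ he

lemma Pf_an (q₀ p₀ : ℝ) {e β : ℝ} (he : |e| < 1) : AnalyticAt ℝ (Pf q₀ p₀) (e, β) :=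
  solp_analytic _ _ _ he

lemma fam_deriv (hs : HasSols) (q₁ p₁ q₂ p₂ : ℝ) {e β : ℝ} (he : e ∈ Set.Ico (0:ℝ) 1)
    (hβ : β ∈ Set.Icc (0:ℝ) 1) :
    deriv (fun b => Pf q₁ p₁ (e, b) piI) β * Qf q₂ p₂ (e, β) piI -
      deriv (fun b => Qf q₁ p₁ (e, b) piI) β * Pf q₂ p₂ (e, β) piI =
    volt (wI e * Qf q₁ p₁ (e, β) * Qf q₂ p₂ (e, β)) piI := by
  have he' := abs_lt_of_mem he
  have hP : HasDerivAt (fun b => Pf q₁ p₁ (e, b) piI) _ β :=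
    (slice_diff (eval_analytic (Pf_an q₁ p₁ he') piI)).hasDerivAt
  have hQ : HasDerivAt (fun b => Qf q₁ p₁ (e, b) piI) _ β :=
    (slice_diff (eval_analytic (Qf_an q₁ p₁ he') piI)).hasDerivAt
  have hI : DifferentiableAt ℝ (fun b => volt (wI e * Qf q₁ p₁ (e, b) * Qf q₂ p₂ (e, β)) piI) β := by
    refine slice_diff
      (f := fun z => volt (wI e * Qf q₁ p₁ z * Qf q₂ p₂ (e, β)) piI) (eval_analytic ?_ piI)
    have h1 : AnalyticAt ℝ (fun z => wI e * Qf q₁ p₁ z * Qf q₂ p₂ (e, β)) (e, β) :=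
      (analyticAt_const.mul (Qf_an q₁ p₁ he')).mul analyticAt_const
    exact (volt.analyticAt _).comp h1
  have hL := (hP.mul_const (Qf q₂ p₂ (e, β) piI)).sub (hQ.mul_const (Pf q₂ p₂ (e, β) piI))
  have hR := (((hasDerivAt_id β).sub_const β).mul hI.hasDerivAt).const_add (p₁ * q₂ - q₁ * p₂)
  have huniq : UniqueDiffWithinAt ℝ (Set.Icc (0:ℝ) 1) β := uniqueDiffOn_Icc_zero_one β hβ
  obtain ⟨y, py, hy, hy0, hpy0⟩ := hs e he β hβ q₂ p₂
  have heq : ∀ b ∈ Set.Icc (0:ℝ) 1,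
      Pf q₁ p₁ (e, b) piI * Qf q₂ p₂ (e, β) piI - Qf q₁ p₁ (e, b) piI * Pf q₂ p₂ (e, β) piI =
      p₁ * q₂ - q₁ * p₂ + (b - β) * volt (wI e * Qf q₁ p₁ (e, b) * Qf q₂ p₂ (e, β)) piI := by
    intro b hb
    obtain ⟨x, px, hx, hx0, hpx0⟩ := hs e he b hb q₁ p₁
    have e1 := Qf_eq hx he'
    have e2 := Pf_eq hx he'
    have e3 := Qf_eq hy he'
    have e4 := Pf_eq hy he'
    have e5 := IsSol.wr_int he' hx hy
    rw [hx0, hpx0] at e1 e2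
    rw [hy0, hpy0] at e3 e4
    rw [hx0, hpx0, hy0, hpy0] at e5
    rw [e1, e2, e3, e4, IsSol.volt_int he' hx.contq hy.contq]
    exact e5
  have h1 := hL.hasDerivWithinAt (s := Set.Icc (0:ℝ) 1)
  have h2 := (hR.hasDerivWithinAt (s := Set.Icc (0:ℝ) 1)).congr (fun b hb => heq b hb) (heq β hβ)
  have h3 := huniq.eq_deriv _ h1 h2
  rw [h3]
  simp

lemma fam_const (hs : HasSols) (q₁ p₁ q₂ p₂ : ℝ) {e β : ℝ} (he : e ∈ Set.Ico (0:ℝ) 1)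
    (hβ : β ∈ Set.Icc (0:ℝ) 1) :
    Pf q₁ p₁ (e, β) piI * Qf q₂ p₂ (e, β) piI - Qf q₁ p₁ (e, β) piI * Pf q₂ p₂ (e, β) piI =
      p₁ * q₂ - q₁ * p₂ := by
  have he' := abs_lt_of_mem he
  obtain ⟨y, py, hy, hy0, hpy0⟩ := hs e he β hβ q₂ p₂
  obtain ⟨x, px, hx, hx0, hpx0⟩ := hs e he β hβ q₁ p₁
  have e1 := Qf_eq hx he'
  have e2 := Pf_eq hx he'
  have e3 := Qf_eq hy he'
  have e4 := Pf_eq hy he'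
  have e5 := IsSol.wr_const hx hy π 0
  rw [hx0, hpx0] at e1 e2
  rw [hy0, hpy0] at e3 e4
  rw [hx0, hpx0, hy0, hpy0] at e5
  rw [e1, e2, e3, e4]
  exact e5

/-- comparison with an explicit solution -/
lemma fam_explicit (hs : HasSols) (q₁ p₁ : ℝ) {e β : ℝ} (he : e ∈ Set.Ico (0:ℝ) 1)
    (hβ : β ∈ Set.Icc (0:ℝ) 1) {y py : ℝ → ℝ} (hy : IsSol e β y py) :
    Pf q₁ p₁ (e, β) piI * y π - Qf q₁ p₁ (e, β) piI * py π = p₁ * y 0 - q₁ * py 0 := by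
  have he' := abs_lt_of_mem he
  obtain ⟨x, px, hx, hx0, hpx0⟩ := hs e he β hβ q₁ p₁
  have e1 := Qf_eq hx he'
  have e2 := Pf_eq hx he'
  have e5 := IsSol.wr_const hx hy π 0
  rw [hx0, hpx0] at e1 e2
  rw [hx0, hpx0] at e5
  rw [e1, e2]
  exact e5

lemma scalarData (hs : HasSols) {e : ℝ} (he : e ∈ Set.Ico (0:ℝ) 1) :
    ScalarData (fun β => Qf 1 0 (e, β) piI) (fun β => Pf 0 1 (e, β) piI)
      (fun β => Pf 1 0 (e, β) piI) (fun β => Qf 0 1 (e, β) piI)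
      (fun β => volt (wI e * Qf 1 0 (e, β) * Qf 1 0 (e, β)) piI)
      (fun β => volt (wI e * Qf 0 1 (e, β) * Qf 0 1 (e, β)) piI)
      (fun β => volt (wI e * Qf 1 0 (e, β) * Qf 0 1 (e, β)) piI) := by
  have he' := abs_lt_of_mem he
  have hdet : ∀ β ∈ Set.Icc (0:ℝ) 1, Qf 1 0 (e, β) piI * Pf 0 1 (e, β) piI -
      Pf 1 0 (e, β) piI * Qf 0 1 (e, β) piI = 1 := by
    intro β hβ
    have := fam_const hs 1 0 0 1 he hβ
    linarith
  have m0 : (0:ℝ) ∈ Set.Icc (0:ℝ) 1 := by simp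
  have m1 : (1:ℝ) ∈ Set.Icc (0:ℝ) 1 := by simp
  constructor
  · intro β hβ
    have hd : HasDerivAt (fun b => Qf 1 0 (e, b) piI) _ β :=
      (slice_diff (eval_analytic (Qf_an 1 0 he') piI)).hasDerivAt
    refine hd.congr_deriv ?_
    have h1 := fam_deriv hs 1 0 1 0 he hβ
    have h2 := fam_deriv hs 1 0 0 1 he hβ
    have h3 := hdet β hβ
    linear_combination Qf 0 1 (e, β) piI * h1 - Qf 1 0 (e, β) piI * h2
      - deriv (fun b => Qf 1 0 (e, b) piI) β * h3
  · intro β hβ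
    have hd : HasDerivAt (fun b => Pf 0 1 (e, b) piI) _ β :=
      (slice_diff (eval_analytic (Pf_an 0 1 he') piI)).hasDerivAt
    refine hd.congr_deriv ?_
    have h1 := fam_deriv hs 0 1 0 1 he hβ
    have h2 := fam_deriv hs 0 1 1 0 he hβ
    have h3 := hdet β hβ
    have h4 : wI e * Qf 0 1 (e, β) * Qf 1 0 (e, β) = wI e * Qf 1 0 (e, β) * Qf 0 1 (e, β) := by
      ring
    rw [h4] at h2
    linear_combination -Pf 1 0 (e, β) piI * h1 + Pf 0 1 (e, β) piI * h2
      - deriv (fun b => Pf 0 1 (e, b) piI) β * h3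
  · intro β hβ
    have hd : HasDerivAt (fun b => Pf 1 0 (e, b) piI) _ β :=
      (slice_diff (eval_analytic (Pf_an 1 0 he') piI)).hasDerivAt
    refine hd.congr_deriv ?_
    have h1 := fam_deriv hs 1 0 1 0 he hβ
    have h2 := fam_deriv hs 1 0 0 1 he hβ
    have h3 := hdet β hβ
    linear_combination Pf 0 1 (e, β) piI * h1 - Pf 1 0 (e, β) piI * h2
      - deriv (fun b => Pf 1 0 (e, b) piI) β * h3
  · intro β hβ
    obtain ⟨x, px, hx, hx0, hpx0⟩ := hs e he β hβ 1 0
    have e1 := Qf_eq hx he'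
    rw [hx0, hpx0] at e1
    simp only [e1]
    rw [IsSol.volt_int he' hx.contq hx.contq]
    exact IsSol.int_pos he' hx ⟨0, ⟨le_rfl, pi_nonneg⟩, by rw [hx0]; norm_num⟩
  · intro β hβ
    obtain ⟨x, px, hx, hx0, hpx0⟩ := hs e he β hβ 0 1
    have e1 := Qf_eq hx he'
    rw [hx0, hpx0] at e1
    simp only [e1]
    rw [IsSol.volt_int he' hx.contq hx.contq]
    exact IsSol.int_pos he' hx (hx.ne_of_deriv hx0 hpx0)
  · exact hdet
  · have := fam_explicit hs 1 0 he m0 (IsSol.sin_sol e)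
    simp at this
    linarith
  · have := fam_explicit hs 0 1 he m0 (IsSol.cos_sol e)
    simp at this
    linarith
  · have := fam_explicit hs 1 0 he m0 (IsSol.cos_sol e)
    simpa using this
  · have := fam_explicit hs 1 0 he m1 (IsSol.phi_sol he')
    have h1 : 1 + e * (-1) ≠ 0 := by have := he.2; intro h; linarith
    simp only [Real.cos_pi, Real.sin_pi, Real.sin_zero, Real.cos_zero, mul_zero, neg_zero, sub_zero,
      zero_mul] at this
    exact (mul_eq_zero.1 this).resolve_right h1
  · have := fam_explicit hs 0 1 he m1 (IsSol.phi_sol he')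
    have h1 : 0 < 1 + e * (-1) := by have := he.2; linarith
    have h2 := he.1
    simp only [Real.cos_pi, Real.sin_pi, Real.sin_zero, Real.cos_zero, mul_zero, neg_zero, sub_zero] at this
    have h3 : 0 < Pf 0 1 (e, 1) piI * (1 + e * (-1)) := by rw [this]; linarith
    exact pos_of_mul_pos_left h3 h1.le
  · intro β hβ
    obtain ⟨x, px, hx, hx0, hpx0⟩ := hs e he β ⟨hβ.1.le, hβ.2⟩ 0 1
    have e1 := Qf_eq hx he'
    rw [hx0, hpx0] at e1
    simp only [e1]
    exact IsSol.sturm he' hβ.1 hx hx0 hpx0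

/-- for each `ω ∈ 𝕌 \ {1}` there are two real-analytic `ω`-degeneracy curves
`e ↦ βᵢ(e,ω) ∈ (0,1)` such that `γ_{β,e}(2π)` is `ω`-degenerate iff `β ∈ {β₁(e,ω), β₂(e,ω)}`. -/
theorem stmt_7 (ω : ℂ) (hω : ‖ω‖ = 1) (hω1 : ω ≠ 1)
    (γ : ℝ → ℝ → ℝ → Matrix (Fin 2) (Fin 2) ℝ)
    (hγ : ∀ β ∈ Set.Icc (0 : ℝ) 1, ∀ e ∈ Set.Ico (0 : ℝ) 1, IsFundSol β e (γ β e)) :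
    ∃ β₁ β₂ : ℝ → ℝ,
      AnalyticOnNhd ℝ β₁ (Set.Ico 0 1) ∧ AnalyticOnNhd ℝ β₂ (Set.Ico 0 1) ∧
      (∀ e ∈ Set.Ico (0 : ℝ) 1, β₁ e ∈ Set.Ioo (0 : ℝ) 1 ∧ β₂ e ∈ Set.Ioo (0 : ℝ) 1) ∧
      (∀ e ∈ Set.Ico (0 : ℝ) 1, ∀ β ∈ Set.Icc (0 : ℝ) 1,
        (Matrix.det ((γ β e (2 * π)).map (fun x => (x : ℂ)) - ω • 1) = 0 ↔
          β = β₁ e ∨ β = β₂ e)) := by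
  have hs : HasSols := by
    intro e he β hβ q₀ p₀
    obtain ⟨h0, h⟩ := hγ β hβ e he
    refine ⟨fun t => p₀ * γ β e t 1 0 + q₀ * γ β e t 1 1,
      fun t => p₀ * γ β e t 0 0 + q₀ * γ β e t 0 1, ?_, ?_, ?_⟩
    · intro t
      have h00 := h t 0 0
      have h01 := h t 0 1
      have h10 := h t 1 0
      have h11 := h t 1 1
      simp only [Jmat, Bmat, Matrix.mul_apply, Fin.sum_univ_two, Matrix.of_apply, Matrix.cons_val',
        Matrix.cons_val_zero, Matrix.cons_val_one, Matrix.cons_val_fin_one] at h00 h01 h10 h11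
      exact ⟨((h10.const_mul p₀).add (h11.const_mul q₀)).congr_deriv (by ring),
        ((h00.const_mul p₀).add (h01.const_mul q₀)).congr_deriv (by ring)⟩
    · simp [h0]
    · simp [h0]
  have hre : ω.re ^ 2 + ω.im ^ 2 = 1 := by
    have h1 := Complex.sq_norm ω
    rw [hω, Complex.normSq_apply] at h1
    nlinarith
  have hre1 : -1 ≤ ω.re := by nlinarith [sq_nonneg ω.im]
  have hre2 : ω.re < 1 := by
    by_contra hn
    push Not at hn
    have h1 : ω.re = 1 := by nlinarith [sq_nonneg ω.im]
    have h2 : ω.im = 0 := by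
      rw [h1] at hre
      have : ω.im ^ 2 = 0 := by linarith
      simpa using this
    exact hω1 (Complex.ext (by simpa using h1) (by simpa using h2))
  obtain ⟨β₁, β₂, h1, h2, h3, h4⟩ := abstract_main
    (a := fun z => Qf 1 0 z piI) (b := fun z => Pf 0 1 z piI) (c := fun z => Pf 1 0 z piI)
    (d := fun z => Qf 0 1 z piI) (U := fun z => volt (wI z.1 * Qf 1 0 z * Qf 1 0 z) piI)
    (V := fun z => volt (wI z.1 * Qf 0 1 z * Qf 0 1 z) piI)
    (W := fun z => volt (wI z.1 * Qf 1 0 z * Qf 0 1 z) piI)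
    (fun e he β _ => eval_analytic (Qf_an 1 0 (abs_lt_of_mem he)) piI)
    (fun e he β _ => eval_analytic (Pf_an 0 1 (abs_lt_of_mem he)) piI)
    (fun e he => scalarData hs he) (κ := (1 + ω.re) / 2) (by linarith) (by linarith)
  refine ⟨β₁, β₂, h1, h2, h3, fun e he β hβ => ?_⟩
  rw [← h4 e he β hβ]
  have he' := abs_lt_of_mem he
  obtain ⟨h0, h⟩ := hγ β hβ e he
  have hu : IsSol e β (fun t => γ β e t 1 1) (fun t => γ β e t 0 1) := by
    intro t
    have h01 := h t 0 1
    have h11 := h t 1 1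
    simp only [Jmat, Bmat, Matrix.mul_apply, Fin.sum_univ_two, Matrix.of_apply, Matrix.cons_val',
      Matrix.cons_val_zero, Matrix.cons_val_one, Matrix.cons_val_fin_one] at h01 h11
    exact ⟨h11.congr_deriv (by ring), h01.congr_deriv (by ring)⟩
  have hv : IsSol e β (fun t => γ β e t 1 0) (fun t => γ β e t 0 0) := by
    intro t
    have h00 := h t 0 0
    have h10 := h t 1 0
    simp only [Jmat, Bmat, Matrix.mul_apply, Fin.sum_univ_two, Matrix.of_apply, Matrix.cons_val',
      Matrix.cons_val_zero, Matrix.cons_val_one, Matrix.cons_val_fin_one] at h00 h10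
    exact ⟨h10.congr_deriv (by ring), h00.congr_deriv (by ring)⟩
  have g00 : γ β e 0 0 0 = 1 := by rw [h0]; simp
  have g01 : γ β e 0 0 1 = 0 := by rw [h0]; simp
  have g10 : γ β e 0 1 0 = 0 := by rw [h0]; simp
  have g11 : γ β e 0 1 1 = 1 := by rw [h0]; simp
  have ea : Qf 1 0 (e, β) piI = γ β e π 1 1 := by
    have := Qf_eq hu he'
    simp only [g11, g01] at this
    rw [this]; rfl
  have eb : Pf 0 1 (e, β) piI = γ β e π 0 0 := by
    have := Pf_eq hv he'
    simp only [g10, g00] at this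
    rw [this]; rfl
  simp only [ea, eb]
  have hpi : 2 * π - π = π := by ring
  have w1 := IsSol.wr_const hu hv π 0
  have w2 := IsSol.wr_const hu hv (2 * π) 0
  have w3 := IsSol.wr_const hv hu.reflect π 0
  have w4 := IsSol.wr_const hu hv.reflect π 0
  simp only [g00, g01, g10, g11, hpi, sub_zero] at w1 w2 w3 w4
  have t11 : γ β e (2 * π) 1 1 = 2 * (γ β e π 1 1 * γ β e π 0 0) - 1 := by linarith
  have t00 : γ β e (2 * π) 0 0 = 2 * (γ β e π 1 1 * γ β e π 0 0) - 1 := by linarith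
  generalize γ β e π 1 1 * γ β e π 0 0 = f at *
  have hdet : γ β e (2 * π) 0 0 * γ β e (2 * π) 1 1
      - γ β e (2 * π) 0 1 * γ β e (2 * π) 1 0 = 1 := by linarith
  have hdetC : (γ β e (2 * π) 0 0 : ℂ) * γ β e (2 * π) 1 1
      - γ β e (2 * π) 0 1 * γ β e (2 * π) 1 0 = 1 := by exact_mod_cast hdet
  have hconj : ω * (starRingEnd ℂ) ω = 1 := by
    rw [Complex.mul_conj, Complex.normSq_eq_norm_sq, hω]; simp
  have hadd : ω + (starRingEnd ℂ) ω = ((2 * ω.re : ℝ) : ℂ) := Complex.add_conj ω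
  have hω0 : ω ≠ 0 := by
    intro h; rw [h] at hω; simp at hω
  have hD : Matrix.det ((γ β e (2 * π)).map (fun x => (x : ℂ)) - ω • 1) =
      ω * ((2 * ω.re - 2 * (2 * f - 1) : ℝ) : ℂ) := by
    rw [Matrix.det_fin_two]
    simp only [Matrix.sub_apply, Matrix.map_apply, Matrix.smul_apply, Matrix.one_apply_eq,
      smul_eq_mul, mul_one, ne_eq, zero_ne_one, one_ne_zero, not_false_eq_true,
      Matrix.one_apply_ne, mul_zero, sub_zero]
    have c11 : (γ β e (2 * π) 1 1 : ℂ) = ((2 * f - 1 : ℝ) : ℂ) := by rw [t11]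
    have c00 : (γ β e (2 * π) 0 0 : ℂ) = ((2 * f - 1 : ℝ) : ℂ) := by rw [t00]
    push_cast at hadd c11 c00 ⊢
    linear_combination hdetC - hconj + ω * hadd - ω * c11 - ω * c00
  rw [hD, mul_eq_zero, or_iff_right hω0, Complex.ofReal_eq_zero]
  constructor <;> intro h <;> linarith
end
end
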